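/- arXiv:1211.3430 — 3 statements merged into one kernel-verified Lean document; each statement's English description precedes it below -/
import Mathlib

section
/- For every ρ with 1/2 < ρ < 4/7 there exist c > 0 and n₀ such that for every odd integer n ≥ n₀, setting N = 2^n and r = ⌈n^ρ⌉, the number of primes p < N whose binary digit sum satisfies s(p) > n/2 + r/3 is at least c · 2^{−r} N/n. -/
open Finset

/-- Binary digit sum of a natural number. -/
def digitSum (x : ℕ) : ℕ := (Nat.digits 2 x).sum

open ArithmeticFunction in
theorem sum_Ioc_mul_apply_mul (f g : ArithmeticFunction ℝ) (φ : ℕ → ℂ) (N : ℕ) :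
    ∑ x ∈ Ioc 0 N, ((f * g) x : ℂ) * φ x =
      ∑ d ∈ Ioc 0 N, (f d : ℂ) * ∑ k ∈ Ioc 0 (N / d), (g k : ℂ) * φ (d * k) := by
  have h1 : ∑ x ∈ Ioc 0 N, ((f * g) x : ℂ) * φ x =
      ∑ y ∈ Ioc 0 N ×ˢ Ioc 0 N with y.1 * y.2 ≤ N, (f y.1 : ℂ) * (g y.2 * φ (y.1 * y.2)) := by
    trans ∑ n ∈ Ioc 0 N, ∑ y ∈ Ioc 0 N ×ˢ Ioc 0 N with y.1 * y.2 = n,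
      (f y.1 : ℂ) * (g y.2 * φ (y.1 * y.2))
    · refine sum_congr rfl fun n hn ↦ ?_
      simp only [mem_Ioc] at hn
      rw [mul_apply, Nat.divisorsAntidiagonal_eq_prod_filter_of_le hn.1.ne' hn.2]
      push_cast
      rw [sum_mul]
      refine sum_congr rfl fun y hy ↦ ?_
      rw [(mem_filter.1 hy).2, mul_assoc]
    · simp_rw [sum_filter]
      rw [sum_comm]
      exact sum_congr rfl fun _ _ ↦ (by simp_all)
  rw [h1, sum_filter, sum_product]
  refine sum_congr rfl fun n hn ↦ ?_
  simp only [sum_ite, not_le, sum_const_zero, add_zero, mul_sum]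
  congr 1
  ext m
  simp only [mem_filter, mem_Ioc, and_assoc, and_congr_right_iff] at hn ⊢
  intro _
  rw [Nat.le_div_iff_mul_le hn.1, mul_comm m]
  exact ⟨fun h ↦ h.2, fun h ↦ ⟨(Nat.le_mul_of_pos_left m hn.1).trans h, h⟩⟩

theorem norm_sum_Ico_pow_le {ω : ℂ} {q : ℕ} (hq : 0 < q) (hω : ω ^ q = 1) (h1 : ω ≠ 1)
    (a b : ℕ) : ‖∑ i ∈ Ico a b, ω ^ i‖ ≤ q := by
  have hn : ‖ω‖ = 1 := Complex.norm_eq_one_of_pow_eq_one hω hq.ne'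
  have key : ∀ l : ℕ, ∑ i ∈ range l, ω ^ i = ∑ i ∈ range (l % q), ω ^ i := fun l ↦ by
    rw [geom_sum_eq h1, geom_sum_eq h1, ← pow_mod_orderOf ω l, ← pow_mod_orderOf ω (l % q),
      Nat.mod_mod_of_dvd _ (orderOf_dvd_of_pow_eq_one hω)]
  rw [sum_Ico_eq_sum_range]
  simp_rw [pow_add]
  rw [← mul_sum, norm_mul, norm_pow, hn, one_pow, one_mul, key]
  refine (norm_sum_le _ _).trans ?_
  simp only [norm_pow, hn, one_pow, sum_const, card_range, nsmul_eq_mul, mul_one]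
  exact_mod_cast (Nat.mod_lt _ hq).le

/-- A bound for incomplete sums of the powers of the `d`-th power of a `q`-th root of unity. -/
def periodBound (q d M : ℕ) : ℝ := if q ∣ d then M else q

theorem periodBound_nonneg (q d M : ℕ) : 0 ≤ periodBound q d M := by
  unfold periodBound; split_ifs <;> positivity

theorem norm_sum_Ioc_pow_mul_le {ζ : ℂ} {q : ℕ} (hq : 0 < q) (hζ : IsPrimitiveRoot ζ q)
    (d M M' : ℕ) (hM : M ≤ M') : ‖∑ m ∈ Ioc 0 M, ζ ^ (d * m)‖ ≤ periodBound q d M' := by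
  have hn : ‖ζ‖ = 1 := Complex.norm_eq_one_of_pow_eq_one hζ.pow_eq_one hq.ne'
  unfold periodBound
  split_ifs with h
  · refine (norm_sum_le _ _).trans ?_
    simp [hn, hM]
  · have := norm_sum_Ico_pow_le (ω := ζ ^ d) hq
      (by rw [← pow_mul, mul_comm, pow_mul, hζ.pow_eq_one, one_pow])
      (fun h' ↦ h ((hζ.pow_eq_one_iff_dvd d).1 h')) 1 (M + 1)
    simp_rw [← pow_mul] at this
    exact this

theorem norm_sum_log_mul_le {a : ℕ → ℂ} {B : ℝ} (M : ℕ)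
    (h : ∀ m ≤ M, ‖∑ i ∈ Ioc 0 m, a i‖ ≤ B) :
    ‖∑ i ∈ Ioc 0 M, (Real.log i : ℂ) * a i‖ ≤ 2 * B * Real.log M := by
  have hlog : ∀ m : ℕ, 0 ≤ Real.log m := fun m ↦ Real.log_natCast_nonneg m
  have key : ∀ m ≤ M, ‖∑ i ∈ Ioc 0 m, (Real.log i : ℂ) * a i
      - (Real.log m : ℂ) * ∑ i ∈ Ioc 0 m, a i‖ ≤ B * Real.log m := by
    intro m
    induction m with
    | zero => simp
    | succ m ih =>
      intro hm
      have hmono : Real.log m ≤ Real.log (m + 1 : ℕ) := by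
        rcases Nat.eq_zero_or_pos m with rfl | hm0
        · simp
        · exact Real.log_le_log (by positivity) (by simp)
      rw [sum_Ioc_succ_top (by simp), sum_Ioc_succ_top (by simp)]
      have e : ∑ i ∈ Ioc 0 m, (Real.log i : ℂ) * a i + (Real.log (m + 1 : ℕ) : ℂ) * a (m + 1)
          - (Real.log (m + 1 : ℕ) : ℂ) * (∑ i ∈ Ioc 0 m, a i + a (m + 1))
          = (∑ i ∈ Ioc 0 m, (Real.log i : ℂ) * a i - (Real.log m : ℂ) * ∑ i ∈ Ioc 0 m, a i)
            - ((Real.log (m + 1 : ℕ) - Real.log m : ℝ) : ℂ) * ∑ i ∈ Ioc 0 m, a i := by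
        push_cast; ring
      rw [e]
      refine (norm_sub_le _ _).trans ?_
      rw [norm_mul, Complex.norm_real, Real.norm_of_nonneg (sub_nonneg.2 hmono)]
      have h2 := mul_le_mul_of_nonneg_left (h m (by lia)) (sub_nonneg.2 hmono)
      have h3 := ih (by lia)
      linarith
  have h1 := key M le_rfl
  have h2 : ‖(Real.log M : ℂ) * ∑ i ∈ Ioc 0 M, a i‖ ≤ Real.log M * B := by
    rw [norm_mul, Complex.norm_real, Real.norm_of_nonneg (hlog M)]
    exact mul_le_mul_of_nonneg_left (h M le_rfl) (hlog M)
  have h3 := norm_sub_norm_le (∑ i ∈ Ioc 0 M, (Real.log i : ℂ) * a i)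
    ((Real.log M : ℂ) * ∑ i ∈ Ioc 0 M, a i)
  linarith

theorem sum_Ioc_filter_dvd_inv_le {q : ℕ} (hq : 0 < q) (D : ℕ) :
    ∑ d ∈ Ioc 0 D with q ∣ d, (d : ℝ)⁻¹ ≤ (1 + Real.log D) / q := by
  calc ∑ d ∈ Ioc 0 D with q ∣ d, (d : ℝ)⁻¹
      ≤ ∑ d ∈ (Ioc 0 D).image (q * ·), (d : ℝ)⁻¹ := by
        refine sum_le_sum_of_subset_of_nonneg ?_ fun _ _ _ ↦ by positivity
        intro d hd
        simp only [mem_filter, mem_Ioc] at hd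
        obtain ⟨⟨h0, hD⟩, k, rfl⟩ := hd
        simp only [mem_image, mem_Ioc]
        exact ⟨k, ⟨Nat.pos_of_mul_pos_left h0, (Nat.le_mul_of_pos_left k hq).trans hD⟩, rfl⟩
    _ = ∑ d ∈ Ioc 0 D, ((q * d : ℕ) : ℝ)⁻¹ :=
        sum_image fun a _ b _ hab ↦ Nat.eq_of_mul_eq_mul_left hq hab
    _ = (∑ d ∈ Ioc 0 D, (d : ℝ)⁻¹) / q := by
        rw [sum_div]; exact sum_congr rfl fun d _ ↦ by push_cast; rw [mul_inv]; ring
    _ ≤ (1 + Real.log D) / q := by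
        gcongr
        have := harmonic_le_one_add_log D
        rw [harmonic_eq_sum_Icc] at this
        push_cast at this
        exact this

theorem sum_periodBound_le {q : ℕ} (hq : 0 < q) (D N : ℕ) :
    ∑ d ∈ Ioc 0 D, periodBound q d (N / d) ≤ D * q + N * (1 + Real.log D) / q := by
  have h1 : ∀ d ∈ Ioc 0 D, periodBound q d (N / d) ≤
      q + N * (if q ∣ d then (d : ℝ)⁻¹ else 0) := by
    intro d hd
    unfold periodBound
    split_ifs
    · have : ((N / d : ℕ) : ℝ) ≤ N / d := Nat.cast_div_le
      rw [← div_eq_mul_inv]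
      have : (0 : ℝ) ≤ q := by positivity
      linarith
    · simp
  refine (sum_le_sum h1).trans ?_
  rw [sum_add_distrib, ← mul_sum, ← sum_filter]
  simp only [sum_const, Nat.card_Ioc, tsub_zero, nsmul_eq_mul]
  rw [mul_div_assoc]
  gcongr
  exact sum_Ioc_filter_dvd_inv_le hq D

theorem norm_sum_mul_apply_le {f g : ArithmeticFunction ℝ} {φ : ℕ → ℂ} {q D N : ℕ} {C G : ℝ}
    (hq : 0 < q) (hG : 0 ≤ G) (hDN : D ≤ N) (hf : ∀ d ∈ Ioc 0 D, |f d| ≤ C)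
    (hfD : ∀ d ∈ Ioc 0 N, D < d → f d = 0)
    (hg : ∀ d ∈ Ioc 0 D, ‖∑ k ∈ Ioc 0 (N / d), (g k : ℂ) * φ (d * k)‖
      ≤ G * periodBound q d (N / d)) (hC : 0 ≤ C) :
    ‖∑ x ∈ Ioc 0 N, ((f * g) x : ℂ) * φ x‖ ≤
      C * G * (D * q + N * (1 + Real.log D) / q) := by
  rw [sum_Ioc_mul_apply_mul]
  have h0 : ∑ d ∈ Ioc 0 N, (f d : ℂ) * ∑ k ∈ Ioc 0 (N / d), (g k : ℂ) * φ (d * k)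
      = ∑ d ∈ Ioc 0 D, (f d : ℂ) * ∑ k ∈ Ioc 0 (N / d), (g k : ℂ) * φ (d * k) := by
    symm
    apply sum_subset (Ioc_subset_Ioc_right hDN)
    intro d hd hd'
    rw [hfD d hd (by simp at hd hd'; lia)]
    simp
  rw [h0]
  calc _ ≤ ∑ d ∈ Ioc 0 D, C * (G * periodBound q d (N / d)) := by
        refine (norm_sum_le _ _).trans (sum_le_sum fun d hd ↦ ?_)
        rw [norm_mul, Complex.norm_real, Real.norm_eq_abs]
        exact mul_le_mul (hf d hd) (hg d hd) (norm_nonneg _) hC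
    _ = C * G * ∑ d ∈ Ioc 0 D, periodBound q d (N / d) := by
        rw [mul_sum]; exact sum_congr rfl fun d _ ↦ by ring
    _ ≤ _ := by gcongr; exact sum_periodBound_le hq D N

theorem card_filter_Ioc_modEq_le {q : ℕ} (hq : 0 < q) (M k : ℕ) :
    (#{k' ∈ Ioc 0 M | k' ≡ k [MOD q]} : ℝ) ≤ M / q + 1 := by
  have h := Nat.Ioc_filter_modEq_card 0 M (r := q) hq k
  have h1 := Int.floor_le (((M : ℚ) - k) / q)
  have h2 := Int.lt_floor_add_one ((((0 : ℕ) : ℚ) - k) / q)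
  have h3 : (#{k' ∈ Ioc 0 M | k' ≡ k [MOD q]} : ℚ) ≤ M / q + 1 := by
    have : (#{k' ∈ Ioc 0 M | k' ≡ k [MOD q]} : ℚ) = ((#{k' ∈ Ioc 0 M | k' ≡ k [MOD q]} : ℤ) : ℚ) :=
      by push_cast; rfl
    rw [this, h]
    push_cast
    refine max_le ?_ (by positivity)
    have e : ((M : ℚ) - k) / q - (((0 : ℕ) : ℚ) - k) / q = M / q := by push_cast; ring
    push_cast at *
    linarith
  have h4 := (Rat.cast_le (K := ℝ)).2 h3
  push_cast at h4
  exact h4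

theorem norm_sum_dyadic_sq_le {ζ : ℂ} {q : ℕ} (hq : 0 < q) (hζ : IsPrimitiveRoot ζ q)
    {b c : ℕ → ℝ} {L : ℝ} {N P : ℕ} (hP : 0 < P) (hc : ∀ d, |c d| ≤ 1)
    (hb : ∀ k ∈ Ioc 0 N, |b k| ≤ L) (hL : 0 ≤ L) :
    ‖∑ d ∈ Ico P (2 * P), (c d : ℂ) * ∑ k ∈ Ioc 0 (N / d), (b k : ℂ) * ζ ^ (d * k)‖ ^ 2
      ≤ L ^ 2 * (N ^ 2 * q / P + N ^ 2 / q + N * P) := by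
  have hn : ‖ζ‖ = 1 := Complex.norm_eq_one_of_pow_eq_one hζ.pow_eq_one hq.ne'
  set S : ℕ → ℂ := fun d ↦ ∑ k ∈ Ioc 0 (N / d), (b k : ℂ) * ζ ^ (d * k) with hS
  set M := N / P with hM
  have hMP : (M : ℝ) * P ≤ N := by exact_mod_cast Nat.div_mul_le_self N P
  have hCS : ‖∑ d ∈ Ico P (2 * P), (c d : ℂ) * S d‖ ^ 2
      ≤ P * ∑ d ∈ Ico P (2 * P), ‖S d‖ ^ 2 := by
    have h1 : ‖∑ d ∈ Ico P (2 * P), (c d : ℂ) * S d‖ ≤ ∑ d ∈ Ico P (2 * P), ‖S d‖ := by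
      refine (norm_sum_le _ _).trans (sum_le_sum fun d _ ↦ ?_)
      rw [norm_mul, Complex.norm_real, Real.norm_eq_abs]
      exact mul_le_of_le_one_left (norm_nonneg _) (hc d)
    refine (pow_le_pow_left₀ (norm_nonneg _) h1 2).trans ?_
    have := sq_sum_le_card_mul_sum_sq (s := Ico P (2 * P)) (f := fun d ↦ ‖S d‖)
    simpa [two_mul] using this
  have hS' : ∀ d ∈ Ico P (2 * P), S d =
      ∑ k ∈ Ioc 0 M, if d * k ≤ N then (b k : ℂ) * ζ ^ (d * k) else 0 := by
    intro d hd
    rw [mem_Ico] at hd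
    rw [hS, ← sum_filter]
    refine sum_congr ?_ fun _ _ ↦ rfl
    ext k
    simp only [mem_Ioc, mem_filter, and_assoc, and_congr_right_iff, hM]
    intro _
    rw [Nat.le_div_iff_mul_le (by lia), Nat.le_div_iff_mul_le hP, mul_comm k d]
    exact ⟨fun h ↦ ⟨(mul_comm k P ▸ Nat.mul_le_mul_right k hd.1).trans h, h⟩, fun h ↦ h.2⟩
  have hexp : ((∑ d ∈ Ico P (2 * P), ‖S d‖ ^ 2 : ℝ) : ℂ) =
      ∑ k ∈ Ioc 0 M, ∑ k' ∈ Ioc 0 M, (b k : ℂ) * b k' *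
        ∑ d ∈ Ico P (2 * P) with d * k ≤ N ∧ d * k' ≤ N,
          (ζ ^ k * (starRingEnd ℂ ζ) ^ k') ^ d := by
    push_cast
    trans ∑ d ∈ Ico P (2 * P), ∑ k ∈ Ioc 0 M, ∑ k' ∈ Ioc 0 M,
      if d * k ≤ N ∧ d * k' ≤ N then (b k : ℂ) * b k' *
        (ζ ^ k * (starRingEnd ℂ ζ) ^ k') ^ d else 0
    · refine sum_congr rfl fun d hd ↦ ?_
      rw [← Complex.mul_conj', hS' d hd, map_sum, sum_mul_sum]
      refine sum_congr rfl fun k _ ↦ sum_congr rfl fun k' _ ↦ ?_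
      by_cases h1 : d * k ≤ N <;> by_cases h2 : d * k' ≤ N <;> simp [h1, h2]
      ring
    · rw [sum_comm]
      refine sum_congr rfl fun k _ ↦ ?_
      rw [sum_comm]
      refine sum_congr rfl fun k' _ ↦ ?_
      rw [mul_sum, ← sum_filter]
  have hinner : ∀ k ∈ Ioc 0 M, ∀ k' ∈ Ioc 0 M,
      ‖∑ d ∈ Ico P (2 * P) with d * k ≤ N ∧ d * k' ≤ N, (ζ ^ k * (starRingEnd ℂ ζ) ^ k') ^ d‖
        ≤ q + if k' ≡ k [MOD q] then (P : ℝ) else 0 := by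
    intro k hk k' hk'
    rw [mem_Ioc] at hk hk'
    have hconj : starRingEnd ℂ ζ = ζ⁻¹ := (Complex.inv_eq_conj hn).symm
    split_ifs with h
    · refine (norm_sum_le _ _).trans ?_
      simp only [norm_pow, norm_mul, RCLike.norm_conj, hn, one_pow, mul_one, sum_const,
        nsmul_eq_mul]
      have := card_filter_le (Ico P (2 * P)) (fun d ↦ d * k ≤ N ∧ d * k' ≤ N)
      simp only [Nat.card_Ico, two_mul, add_tsub_cancel_right] at this
      have h2 : ((#{d ∈ Ico P (2 * P) | d * k ≤ N ∧ d * k' ≤ N} : ℕ) : ℝ) ≤ P := by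
        rw [two_mul]; exact_mod_cast this
      have : (0 : ℝ) ≤ q := by positivity
      linarith
    · have e : {d ∈ Ico P (2 * P) | d * k ≤ N ∧ d * k' ≤ N}
          = Ico P (min (2 * P) (min (N / k + 1) (N / k' + 1))) := by
        ext d
        simp only [mem_filter, mem_Ico, lt_min_iff, Nat.lt_succ_iff,
          Nat.le_div_iff_mul_le hk.1, Nat.le_div_iff_mul_le hk'.1]
        tauto
      rw [e, add_zero]
      have hz : ζ ≠ 0 := hζ.ne_zero hq.ne'
      refine norm_sum_Ico_pow_le hq ?_ (fun h1 ↦ h ?_) _ _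
      · rw [mul_pow, ← pow_mul, ← pow_mul, mul_comm k, mul_comm k', pow_mul, pow_mul, ← map_pow,
          hζ.pow_eq_one]
        simp
      · rw [hconj, inv_pow, mul_inv_eq_one₀ (pow_ne_zero _ hz)] at h1
        rw [← pow_mod_orderOf ζ k, ← pow_mod_orderOf ζ k', ← hζ.eq_orderOf] at h1
        exact (hζ.pow_inj (Nat.mod_lt _ hq) (Nat.mod_lt _ hq) h1).symm
  have hmain : ∑ d ∈ Ico P (2 * P), ‖S d‖ ^ 2 ≤ L ^ 2 * (M * (M * q + P * (M / q + 1))) := by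
    have hpos : 0 ≤ ∑ d ∈ Ico P (2 * P), ‖S d‖ ^ 2 := sum_nonneg fun _ _ ↦ by positivity
    rw [← Real.norm_of_nonneg hpos, ← Complex.norm_real, hexp]
    calc _ ≤ ∑ k ∈ Ioc 0 M, ∑ k' ∈ Ioc 0 M,
          L ^ 2 * (q + if k' ≡ k [MOD q] then (P : ℝ) else 0) := by
          refine (norm_sum_le _ _).trans (sum_le_sum fun k hk ↦ ?_)
          refine (norm_sum_le _ _).trans (sum_le_sum fun k' hk' ↦ ?_)
          rw [norm_mul, norm_mul, Complex.norm_real, Complex.norm_real, Real.norm_eq_abs,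
            Real.norm_eq_abs, sq]
          have hsub : Ioc 0 M ⊆ Ioc 0 N := Ioc_subset_Ioc_right (Nat.div_le_self _ _)
          exact mul_le_mul (mul_le_mul (hb k (hsub hk)) (hb k' (hsub hk')) (abs_nonneg _) hL)
            (hinner k hk k' hk') (norm_nonneg _) (by positivity)
      _ ≤ ∑ k ∈ Ioc 0 M, L ^ 2 * (M * q + P * (M / q + 1)) := by
          refine sum_le_sum fun k _ ↦ ?_
          rw [← mul_sum, sum_add_distrib, ← sum_filter]
          simp only [sum_const, Nat.card_Ioc, tsub_zero, nsmul_eq_mul]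
          rw [mul_comm (P : ℝ)]
          gcongr
          exact card_filter_Ioc_modEq_le hq M k
      _ = _ := by
          simp only [sum_const, Nat.card_Ioc, tsub_zero, nsmul_eq_mul]; ring
  refine hCS.trans ((mul_le_mul_of_nonneg_left hmain (by positivity)).trans ?_)
  have hP' : (0 : ℝ) < P := by positivity
  have hq' : (0 : ℝ) < q := by positivity
  have e1 : (P : ℝ) * (L ^ 2 * (M * (M * q + P * (M / q + 1)))) =
      L ^ 2 * ((M * P) ^ 2 * q / P + (M * P) ^ 2 / q + (M * P) * P) := by
    field_simp
    ring
  rw [e1]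
  gcongr

theorem sum_Ico_two_pow {M : Type*} [AddCommMonoid M] (f : ℕ → M) {v w : ℕ} (h : v ≤ w) :
    ∑ d ∈ Ico (2 ^ v) (2 ^ w), f d = ∑ i ∈ Ico v w, ∑ d ∈ Ico (2 ^ i) (2 * 2 ^ i), f d := by
  induction w, h using Nat.le_induction with
  | base => simp
  | succ w h ih =>
    rw [sum_Ico_succ_top h, ← ih, ← pow_succ',
      sum_Ico_consecutive _ (Nat.pow_le_pow_right (by simp) h)
        (Nat.pow_le_pow_right (by simp) (Nat.le_succ w))]

theorem log_two_pow_le (n : ℕ) : Real.log ((2 ^ n : ℕ) : ℝ) ≤ n := by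
  push_cast
  rw [Real.log_pow]
  have := Real.log_two_lt_d9
  have h : (0 : ℝ) ≤ n := by positivity
  nlinarith

theorem norm_sum_mul_bilinear_le {ζ : ℂ} {n K q : ℕ} (hq : 0 < q) (hζ : IsPrimitiveRoot ζ q)
    (hqK : q ≤ 2 ^ K) (hK : 10 * K ≤ n) {b c : ArithmeticFunction ℝ} {L : ℝ} (hL : 0 ≤ L)
    (hc : ∀ d, |c d| ≤ 1) (hb : ∀ k ∈ Ioc 0 (2 ^ n), |b k| ≤ L)
    (hc0 : ∀ d ≤ 2 ^ (3 * K), c d = 0) (hb0 : ∀ k ≤ 2 ^ (3 * K), b k = 0) :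
    ‖∑ x ∈ Ioc 0 (2 ^ n), ((c * b) x : ℂ) * ζ ^ x‖ ≤ n * (2 * L * 2 ^ n / √q) := by
  rw [sum_Ioc_mul_apply_mul c b (fun x ↦ ζ ^ x)]
  set T : ℕ → ℂ := fun d ↦ (c d : ℂ) * ∑ k ∈ Ioc 0 (2 ^ n / d), (b k : ℂ) * ζ ^ (d * k) with hT
  have hsub : Ico (2 ^ (3 * K)) (2 ^ (n - 3 * K)) ⊆ Ioc 0 (2 ^ n) := by
    intro d hd
    rw [mem_Ico] at hd
    rw [mem_Ioc]
    exact ⟨lt_of_lt_of_le (by positivity) hd.1,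
      hd.2.le.trans (Nat.pow_le_pow_right (by simp) (Nat.sub_le _ _))⟩
  have h0 : ∑ d ∈ Ioc 0 (2 ^ n), T d = ∑ d ∈ Ico (2 ^ (3 * K)) (2 ^ (n - 3 * K)), T d := by
    symm
    refine sum_subset hsub fun d hd hd' ↦ ?_
    rw [mem_Ico, not_and_or, not_le, not_lt] at hd'
    rcases hd' with hd' | hd'
    · simp [hT, hc0 d hd'.le]
    · have : ∑ k ∈ Ioc 0 (2 ^ n / d), (b k : ℂ) * ζ ^ (d * k) = 0 := by
        refine sum_eq_zero fun k hk ↦ ?_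
        rw [mem_Ioc] at hk
        rw [hb0 k ?_]
        · simp
        · refine hk.2.trans ((Nat.div_le_div_left hd' (by positivity)).trans ?_)
          rw [Nat.pow_div (Nat.sub_le _ _) (by simp)]
          exact Nat.pow_le_pow_right (by simp) (by lia)
      simp [hT, this]
  rw [h0, sum_Ico_two_pow T (by lia)]
  have hq' : (0 : ℝ) < q := by positivity
  have hblock : ∀ i ∈ Ico (3 * K) (n - 3 * K),
      ‖∑ d ∈ Ico (2 ^ i) (2 * 2 ^ i), T d‖ ≤ 2 * L * 2 ^ n / √q := by
    intro i hi
    rw [mem_Ico] at hi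
    have h1 := norm_sum_dyadic_sq_le hq hζ (b := b) (c := c) (P := 2 ^ i) (by positivity) hc hb hL
    rw [← pow_le_pow_iff_left₀ (norm_nonneg _) (by positivity) two_ne_zero]
    refine h1.trans ?_
    rw [div_pow, Real.sq_sqrt hq'.le]
    push_cast
    have hqK' : (q : ℝ) ≤ 2 ^ K := by exact_mod_cast hqK
    have a1 : ((2 : ℝ) ^ n) ^ 2 * q / 2 ^ i ≤ (2 ^ n) ^ 2 / q := by
      rw [div_le_div_iff₀ (by positivity) hq', mul_assoc]
      gcongr
      calc (q : ℝ) * q ≤ 2 ^ K * 2 ^ K := by gcongr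
        _ = 2 ^ (K + K) := by rw [pow_add]
        _ ≤ 2 ^ i := pow_le_pow_right₀ (by norm_num) (by lia)
    have a2 : (2 : ℝ) ^ n * 2 ^ i ≤ (2 ^ n) ^ 2 / q := by
      rw [le_div_iff₀ hq', sq, mul_assoc]
      gcongr
      calc (2 : ℝ) ^ i * q ≤ 2 ^ i * 2 ^ K := by gcongr
        _ = 2 ^ (i + K) := by rw [pow_add]
        _ ≤ 2 ^ n := pow_le_pow_right₀ (by norm_num) (by lia)
    have a3 : 0 ≤ ((2 : ℝ) ^ n) ^ 2 / q := by positivity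
    calc _ ≤ L ^ 2 * (4 * ((2 ^ n) ^ 2 / q)) := by gcongr; linarith
      _ = _ := by ring
  refine (norm_sum_le _ _).trans ((sum_le_sum hblock).trans ?_)
  rw [sum_const, nsmul_eq_mul, Nat.card_Ico]
  gcongr
  lia

namespace ArithmeticFunction

/-- The restriction of an arithmetic function to `[1, W]`. -/
noncomputable def restrictLE (f : ArithmeticFunction ℝ) (W : ℕ) : ArithmeticFunction ℝ :=
  ⟨fun x ↦ if x ≤ W then f x else 0, by simp⟩

theorem restrictLE_apply (f : ArithmeticFunction ℝ) (W x : ℕ) :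
    f.restrictLE W x = if x ≤ W then f x else 0 := rfl

theorem apply_sub (f g : ArithmeticFunction ℝ) (x : ℕ) : (f - g) x = f x - g x := rfl

theorem sub_restrictLE_apply (f : ArithmeticFunction ℝ) (W x : ℕ) :
    (f - f.restrictLE W) x = if x ≤ W then 0 else f x := by
  rw [apply_sub, restrictLE_apply]
  split_ifs <;> simp

open scoped ArithmeticFunction.Moebius ArithmeticFunction.zeta

theorem vonMangoldt_eq_vaughan (U V : ℕ) :
    Λ = restrictLE Λ U + (μ : ArithmeticFunction ℝ).restrictLE V * log
      - restrictLE Λ U * (μ : ArithmeticFunction ℝ).restrictLE V * (ζ : ArithmeticFunction ℝ)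
      + ((μ : ArithmeticFunction ℝ) - (μ : ArithmeticFunction ℝ).restrictLE V) *
        ((Λ - restrictLE Λ U) * (ζ : ArithmeticFunction ℝ)) := by
  rw [← vonMangoldt_mul_zeta]
  set A := restrictLE Λ U
  set C := (μ : ArithmeticFunction ℝ).restrictLE V
  have h : (μ : ArithmeticFunction ℝ) * (ζ : ArithmeticFunction ℝ) = 1 := coe_moebius_mul_coe_zeta
  linear_combination (A - Λ) * h

theorem abs_coe_moebius_le_one (d : ℕ) : |(μ : ArithmeticFunction ℝ) d| ≤ 1 := by
  rw [intCoe_apply]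
  exact_mod_cast abs_moebius_le_one (n := d)

theorem abs_mul_le_log {f g : ArithmeticFunction ℝ} (hf : ∀ d, |f d| ≤ Λ d) (hg : ∀ d, |g d| ≤ 1)
    (k : ℕ) : |(f * g) k| ≤ Real.log k := by
  rw [mul_apply, ← vonMangoldt_sum, ← Nat.sum_divisorsAntidiagonal (fun i _ ↦ Λ i)]
  refine (abs_sum_le_sum_abs _ _).trans (sum_le_sum fun y _ ↦ ?_)
  rw [abs_mul]
  exact (mul_le_of_le_one_right (abs_nonneg _) (hg _)).trans (hf _)

theorem abs_restrictLE_le {f : ArithmeticFunction ℝ} {W d : ℕ} {B : ℝ} (hB : |f d| ≤ B) :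
    |f.restrictLE W d| ≤ B := by
  rw [restrictLE_apply]
  split_ifs
  · exact hB
  · simpa using (abs_nonneg _).trans hB

theorem abs_sub_restrictLE_le {f : ArithmeticFunction ℝ} {W d : ℕ} {B : ℝ} (hB : |f d| ≤ B) :
    |(f - f.restrictLE W) d| ≤ B := by
  rw [sub_restrictLE_apply]
  split_ifs
  · simpa using (abs_nonneg _).trans hB
  · exact hB

theorem restrictLE_mul_restrictLE_apply_eq_zero (f g : ArithmeticFunction ℝ) {W x : ℕ}
    (h : W * W < x) : (f.restrictLE W * g.restrictLE W) x = 0 := by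
  rw [mul_apply]
  refine sum_eq_zero fun y hy ↦ ?_
  rw [Nat.mem_divisorsAntidiagonal] at hy
  rw [restrictLE_apply, restrictLE_apply]
  split_ifs with h1 h2
  · have := Nat.mul_le_mul h1 h2
    lia
  all_goals simp

theorem sub_restrictLE_mul_apply_eq_zero (f g : ArithmeticFunction ℝ) {W x : ℕ}
    (h : x ≤ W) : ((f - f.restrictLE W) * g) x = 0 := by
  rw [mul_apply]
  refine sum_eq_zero fun y hy ↦ ?_
  rw [sub_restrictLE_apply, if_pos ((Nat.divisor_le (Nat.fst_mem_divisors_of_mem_antidiagonal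
    hy)).trans h), zero_mul]

/-- A bound for the exponential sum over primes at a rational with denominator `q`. -/
theorem norm_sum_vonMangoldt_mul_pow_le {z : ℂ} {n K q : ℕ} (hq : 0 < q)
    (hz : IsPrimitiveRoot z q) (hqK : q ≤ 2 ^ K) (hK : 10 * K ≤ n) :
    ‖∑ x ∈ Ioc 0 (2 ^ n), (Λ x : ℂ) * z ^ x‖ ≤ 12 * n ^ 2 * 2 ^ n / √q := by
  set W := 2 ^ (3 * K) with hW
  have hn : ‖z‖ = 1 := Complex.norm_eq_one_of_pow_eq_one hz.pow_eq_one hq.ne'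
  rcases Nat.eq_zero_or_pos n with rfl | hn0
  · rw [pow_zero, show Ioc 0 1 = {1} from rfl]
    simp
  have hn1 : (1 : ℝ) ≤ n := by exact_mod_cast hn0
  have hΛ : ∀ d, |Λ d| ≤ Λ d := fun d ↦ (abs_of_nonneg vonMangoldt_nonneg).le
  have hlog : ∀ d : ℕ, d ∈ Ioc 0 (2 ^ n) → Real.log d ≤ n := fun d hd ↦ by
    rw [mem_Ioc] at hd
    exact (Real.log_le_log (by exact_mod_cast hd.1) (by exact_mod_cast hd.2)).trans
      (log_two_pow_le n)
  have hζ1 : ∀ d, |(ζ : ArithmeticFunction ℝ) d| ≤ 1 := fun d ↦ by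
    rw [natCoe_apply, zeta_apply]; split_ifs <;> simp
  have hWW : W * W = 2 ^ (6 * K) := by rw [hW, ← pow_add]; congr 1; lia
  have hWWn : W * W ≤ 2 ^ n := hWW ▸ Nat.pow_le_pow_right (by simp) (by lia)
  have hWn : W ≤ 2 ^ n := Nat.pow_le_pow_right (by simp) (by lia)
  set A := restrictLE Λ W with hA
  set C := (μ : ArithmeticFunction ℝ).restrictLE W with hC
  have e : ∑ x ∈ Ioc 0 (2 ^ n), (Λ x : ℂ) * z ^ x =
      ∑ x ∈ Ioc 0 (2 ^ n), (A x : ℂ) * z ^ x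
      + ∑ x ∈ Ioc 0 (2 ^ n), ((C * log) x : ℂ) * z ^ x
      - ∑ x ∈ Ioc 0 (2 ^ n), ((A * C * (ζ : ArithmeticFunction ℝ)) x : ℂ) * z ^ x
      + ∑ x ∈ Ioc 0 (2 ^ n), ((((μ : ArithmeticFunction ℝ) - C) *
          ((Λ - A) * (ζ : ArithmeticFunction ℝ))) x : ℂ) * z ^ x := by
    rw [← sum_add_distrib, ← sum_sub_distrib, ← sum_add_distrib]
    refine sum_congr rfl fun x _ ↦ ?_
    have h := congrArg (fun f : ArithmeticFunction ℝ ↦ ((f x : ℝ) : ℂ)) (vonMangoldt_eq_vaughan W W)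
    simp only [add_apply, apply_sub, ← hA, ← hC] at h
    push_cast at h
    rw [h]
    ring
  have hq1 : (1 : ℝ) ≤ q := by exact_mod_cast hq
  have hsq : √(q : ℝ) ≤ q := Real.sqrt_le_iff.2 ⟨by linarith, by nlinarith⟩
  have hsq0 : 0 < √(q : ℝ) := Real.sqrt_pos.2 (by linarith)
  have hqK' : (q : ℝ) ≤ 2 ^ K := by exact_mod_cast hqK
  set X : ℝ := 2 ^ n / √q with hX
  have hqX : (2 : ℝ) ^ n / q ≤ X := by rw [hX]; gcongr
  have hX0 : 0 ≤ X := by positivity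
  have hWWq : ((W * W : ℕ) : ℝ) * q ≤ X := by
    refine le_trans ?_ hqX
    rw [hWW, le_div_iff₀ (by linarith), mul_assoc]
    push_cast
    calc (2 : ℝ) ^ (6 * K) * (q * q) ≤ 2 ^ (6 * K) * (2 ^ K * 2 ^ K) := by gcongr
      _ = 2 ^ (8 * K) := by rw [← pow_add, ← pow_add]; congr 1; lia
      _ ≤ 2 ^ n := pow_le_pow_right₀ (by norm_num) (by lia)
  have hWX : (W : ℝ) ≤ ((W * W : ℕ) : ℝ) := by exact_mod_cast Nat.le_mul_self W
  have hWq : (W : ℝ) * q ≤ X := le_trans (by gcongr) hWWq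
  have typeI : ∀ D : ℕ, 0 < D → D ≤ 2 ^ n → (D : ℝ) * q ≤ X →
      D * q + ((2 ^ n : ℕ) : ℝ) * (1 + Real.log D) / q ≤ (n + 2) * X := by
    intro D hD0 hD hDq
    have h1 := hlog D (mem_Ioc.2 ⟨hD0, hD⟩)
    have h2 : ((2 ^ n : ℕ) : ℝ) * (1 + Real.log D) / q = (2 : ℝ) ^ n / q * (1 + Real.log D) := by
      push_cast; ring
    rw [h2]
    have h3 : (2 : ℝ) ^ n / q * (1 + Real.log D) ≤ X * (1 + n) :=
      mul_le_mul hqX (by linarith) (by have := Real.log_natCast_nonneg D; linarith) hX0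
    linarith
  have b0 : ‖∑ x ∈ Ioc 0 (2 ^ n), (A x : ℂ) * z ^ x‖ ≤ n * X := by
    have h1 : ∑ x ∈ Ioc 0 (2 ^ n), (A x : ℂ) * z ^ x = ∑ x ∈ Ioc 0 W, (A x : ℂ) * z ^ x := by
      symm
      refine sum_subset (Ioc_subset_Ioc_right hWn) fun d hd hd' ↦ ?_
      rw [mem_Ioc] at hd hd'
      rw [hA, restrictLE_apply, if_neg (by lia)]
      simp
    rw [h1]
    have h2 : ∀ x ∈ Ioc 0 W, ‖(A x : ℂ) * z ^ x‖ ≤ n := fun x hx ↦ by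
      rw [norm_mul, norm_pow, hn, one_pow, mul_one, Complex.norm_real, Real.norm_eq_abs]
      exact (abs_restrictLE_le (hΛ x)).trans
        (vonMangoldt_le_log.trans (hlog x (Ioc_subset_Ioc_right hWn hx)))
    refine (norm_sum_le _ _).trans ((sum_le_sum h2).trans ?_)
    rw [sum_const, nsmul_eq_mul, Nat.card_Ioc, mul_comm]
    gcongr
    exact le_trans (by simpa using le_mul_of_one_le_right (Nat.cast_nonneg W) hq1) hWq
  have b1 : ‖∑ x ∈ Ioc 0 (2 ^ n), ((C * log) x : ℂ) * z ^ x‖ ≤ 2 * n * ((n + 2) * X) := by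
    have := norm_sum_mul_apply_le (f := C) (g := log) (φ := fun x ↦ z ^ x) (D := W)
      (C := 1) (G := 2 * n) hq (by positivity) hWn
      (fun d _ ↦ abs_restrictLE_le (abs_coe_moebius_le_one d))
      (fun d _ hd ↦ by rw [hC, restrictLE_apply, if_neg (by lia)]) ?_ zero_le_one
    · refine this.trans ?_
      rw [one_mul]
      gcongr
      exact typeI W (by positivity) hWn hWq
    · intro d hd
      simp only [log_apply]
      refine (norm_sum_log_mul_le (2 ^ n / d)
        fun m hm ↦ norm_sum_Ioc_pow_mul_le hq hz d m _ hm).trans ?_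
      have h1 : Real.log ((2 ^ n / d : ℕ) : ℝ) ≤ n := by
        rcases Nat.eq_zero_or_pos (2 ^ n / d) with h | h
        · simp [h]
        · exact hlog _ (mem_Ioc.2 ⟨h, Nat.div_le_self _ _⟩)
      have := mul_le_mul_of_nonneg_left h1 (periodBound_nonneg q d (2 ^ n / d))
      linarith
  have b2 : ‖∑ x ∈ Ioc 0 (2 ^ n), ((A * C * (ζ : ArithmeticFunction ℝ)) x : ℂ) * z ^ x‖
      ≤ n * ((n + 2) * X) := by
    have := norm_sum_mul_apply_le (f := A * C) (g := (ζ : ArithmeticFunction ℝ))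
      (φ := fun x ↦ z ^ x) (D := W * W) (C := n) (G := 1) hq zero_le_one hWWn
      (fun d hd ↦ (abs_mul_le_log (fun d ↦ abs_restrictLE_le (hΛ d))
        (fun d ↦ abs_restrictLE_le (abs_coe_moebius_le_one d)) d).trans
        (hlog d (Ioc_subset_Ioc_right hWWn hd)))
      (fun d _ hd ↦ restrictLE_mul_restrictLE_apply_eq_zero _ _ hd) ?_ (by positivity)
    · refine this.trans ?_
      rw [mul_one]
      gcongr
      exact typeI (W * W) (by positivity) hWWn hWWq
    · intro d hd
      rw [one_mul]
      refine le_trans (le_of_eq ?_) (norm_sum_Ioc_pow_mul_le hq hz d _ _ le_rfl)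
      congr 1
      refine sum_congr rfl fun k hk ↦ ?_
      rw [mem_Ioc] at hk
      simp [natCoe_apply, zeta_apply, hk.1.ne']
  have b3 : ‖∑ x ∈ Ioc 0 (2 ^ n), ((((μ : ArithmeticFunction ℝ) - C) *
          ((Λ - A) * (ζ : ArithmeticFunction ℝ))) x : ℂ) * z ^ x‖ ≤ n * (2 * n * X) := by
    have := norm_sum_mul_bilinear_le (b := (Λ - A) * (ζ : ArithmeticFunction ℝ))
      (c := (μ : ArithmeticFunction ℝ) - C) (L := n) hq hz hqK hK (by positivity)
      (fun d ↦ abs_sub_restrictLE_le (abs_coe_moebius_le_one d))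
      (fun k hk ↦ (abs_mul_le_log (fun d ↦ abs_sub_restrictLE_le (hΛ d)) hζ1 k).trans (hlog k hk))
      (fun d hd ↦ by rw [hC, sub_restrictLE_apply, if_pos hd])
      (fun k hk ↦ sub_restrictLE_mul_apply_eq_zero _ _ hk)
    rwa [mul_div_assoc] at this
  rw [e]
  refine (norm_add_le _ _).trans ?_
  refine (add_le_add_left ((norm_sub_le _ _).trans
    (add_le_add_left (norm_add_le _ _) _)) _).trans ?_
  rw [mul_div_assoc, ← hX]
  have : (n : ℝ) * X ≤ n ^ 2 * X := by gcongr; nlinarith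
  nlinarith

end ArithmeticFunction

theorem stdAddChar_mul_natCast {Q : ℕ} [NeZero Q] (h : ZMod Q) (x : ℕ) :
    ZMod.stdAddChar (h * (x : ZMod Q)) = (ZMod.stdAddChar h : ℂ) ^ x := by
  rw [← AddChar.map_nsmul_eq_pow, nsmul_eq_mul, mul_comm]

theorem sum_stdAddChar_pow {Q : ℕ} [NeZero Q] (x : ℕ) :
    ∑ h : ZMod Q, (ZMod.stdAddChar h : ℂ) ^ x = if (x : ZMod Q) = 0 then (Q : ℂ) else 0 := by
  simp_rw [← stdAddChar_mul_natCast]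
  rw [AddChar.sum_mulShift _ (ZMod.isPrimitive_stdAddChar Q), ZMod.card]
  push_cast
  rfl

theorem sum_norm_sq_geom_stdAddChar {Q J : ℕ} [NeZero Q] (hJ : J ≤ Q) :
    ∑ h : ZMod Q, ‖∑ j ∈ range J, (ZMod.stdAddChar h : ℂ) ^ j‖ ^ 2 = Q * J := by
  have h1 : ((∑ h : ZMod Q, ‖∑ j ∈ range J, (ZMod.stdAddChar h : ℂ) ^ j‖ ^ 2 : ℝ) : ℂ) =
      ∑ j ∈ range J, ∑ j' ∈ range J,
        ∑ h : ZMod Q, ZMod.stdAddChar (h * ((j : ZMod Q) - (j' : ZMod Q))) := by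
    push_cast
    trans ∑ h : ZMod Q, ∑ j ∈ range J, ∑ j' ∈ range J,
      ZMod.stdAddChar (h * ((j : ZMod Q) - (j' : ZMod Q)))
    · refine sum_congr rfl fun h _ ↦ ?_
      rw [← Complex.mul_conj', map_sum, sum_mul_sum]
      refine sum_congr rfl fun j _ ↦ sum_congr rfl fun j' _ ↦ ?_
      rw [← stdAddChar_mul_natCast, ← stdAddChar_mul_natCast, ← AddChar.map_neg_eq_conj,
        ← AddChar.map_add_eq_mul]
      congr 1
      ring
    · rw [sum_comm]
      exact sum_congr rfl fun j _ ↦ sum_comm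
  have h2 : ∀ j ∈ range J, ∑ j' ∈ range J,
      ∑ h : ZMod Q, ZMod.stdAddChar (h * ((j : ZMod Q) - (j' : ZMod Q))) = (Q : ℂ) := by
    intro j hj
    rw [sum_eq_single j]
    · simp [ZMod.card]
    · intro j' hj' hne
      rw [AddChar.sum_mulShift _ (ZMod.isPrimitive_stdAddChar Q), if_neg]
      · simp
      · rw [sub_eq_zero, ZMod.natCast_eq_natCast_iff']
        rw [mem_range] at hj hj'
        rw [Nat.mod_eq_of_lt (by lia), Nat.mod_eq_of_lt (by lia)]
        exact fun h ↦ hne h.symm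
    · exact fun h ↦ absurd hj h
  rw [sum_congr rfl h2, sum_const, card_range, nsmul_eq_mul, mul_comm] at h1
  exact_mod_cast h1

/-- The number of representations of `-(x + 1)` modulo `Q` as a sum of two naturals below `J`. -/
def negSumRep (Q J x : ℕ) : ℕ :=
  #{y ∈ range J ×ˢ range J | ((x + (y.1 + y.2 + 1) : ℕ) : ZMod Q) = 0}

theorem mul_negSumRep {Q : ℕ} [NeZero Q] (J x : ℕ) :
    (Q : ℂ) * negSumRep Q J x = ∑ h : ZMod Q, (ZMod.stdAddChar h : ℂ) *
      (∑ j ∈ range J, (ZMod.stdAddChar h : ℂ) ^ j) ^ 2 * (ZMod.stdAddChar h : ℂ) ^ x := by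
  have h1 : ∀ h : ZMod Q, (ZMod.stdAddChar h : ℂ) *
      (∑ j ∈ range J, (ZMod.stdAddChar h : ℂ) ^ j) ^ 2 * (ZMod.stdAddChar h : ℂ) ^ x =
      ∑ y ∈ range J ×ˢ range J, (ZMod.stdAddChar h : ℂ) ^ (x + (y.1 + y.2 + 1)) := by
    intro h
    rw [sq, sum_mul_sum, ← sum_product', mul_sum, sum_mul]
    exact sum_congr rfl fun y _ ↦ by ring
  simp_rw [h1]
  rw [sum_comm]
  simp_rw [sum_stdAddChar_pow]
  rw [← sum_filter, sum_const, nsmul_eq_mul, negSumRep, mul_comm]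

theorem negSumRep_le (Q : ℕ) {J : ℕ} (hJ : J ≤ Q) (x : ℕ) : negSumRep Q J x ≤ J := by
  unfold negSumRep
  calc _ ≤ #(range J) := by
        refine card_le_card_of_injOn Prod.fst (fun y hy ↦ ?_) ?_
        · simp only [coe_filter, mem_product, Set.mem_ofPred_eq] at hy
          exact hy.1.1
        · rintro ⟨a, b⟩ hy ⟨a', b'⟩ hy' h
          simp only [coe_filter, mem_product, Set.mem_ofPred_eq, mem_range] at hy hy' h
          subst h
          have : ((b : ℕ) : ZMod Q) = b' := by
            have := hy.2.trans hy'.2.symm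
            push_cast at this
            simpa using this
          rw [ZMod.natCast_eq_natCast_iff', Nat.mod_eq_of_lt (by lia),
            Nat.mod_eq_of_lt (by lia)] at this
          rw [this]
    _ = J := card_range J

theorem le_mod_of_negSumRep_ne_zero {Q J x : ℕ} (hJ : 2 * J ≤ Q)
    (h : negSumRep Q J x ≠ 0) : Q - 2 * J ≤ x % Q := by
  obtain ⟨y, hy⟩ := card_ne_zero.1 h
  simp only [mem_filter, mem_product, mem_range] at hy
  obtain ⟨⟨h1, h2⟩, h3⟩ := hy
  rw [ZMod.natCast_eq_zero_iff] at h3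
  by_contra! hlt
  have h4 : Q ∣ x % Q + (y.1 + y.2 + 1) := by
    have h5 : Q * (x / Q) + (x % Q + (y.1 + y.2 + 1)) = x + (y.1 + y.2 + 1) := by
      rw [← add_assoc, Nat.div_add_mod]
    rw [← h5] at h3
    exact (Nat.dvd_add_right (dvd_mul_right Q _)).1 h3
  have := Nat.le_of_dvd (by lia) h4
  lia

open ArithmeticFunction in
theorem abs_sum_vonMangoldt_mul_negSumRep_sub_le {n K k : ℕ} (hk : k ≤ K) (hK : 10 * K ≤ n) :
    |∑ x ∈ Ioc 0 (2 ^ n), Λ x * negSumRep (2 ^ K) (2 ^ k) x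
      - 2 ^ (2 * k) / 2 ^ K * ∑ x ∈ Ioc 0 (2 ^ n), Λ x|
      ≤ 2 ^ k * (12 * n ^ 2 * 2 ^ n / √(2 ^ k)) := by
  set Q := 2 ^ K with hQ
  set J := 2 ^ k with hJ
  have : NeZero Q := ⟨by positivity⟩
  have hJQ : J ≤ Q := Nat.pow_le_pow_right (by simp) hk
  set T : ZMod Q → ℂ := fun h ↦ ∑ j ∈ range J, (ZMod.stdAddChar h : ℂ) ^ j with hT
  set S : ZMod Q → ℂ := fun h ↦ ∑ x ∈ Ioc 0 (2 ^ n), (Λ x : ℂ) * (ZMod.stdAddChar h : ℂ) ^ x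
    with hS
  set E : ℝ := 12 * n ^ 2 * 2 ^ n / √(2 ^ k) with hE
  have hE0 : 0 ≤ E := by positivity
  have hexp : (Q : ℂ) * (∑ x ∈ Ioc 0 (2 ^ n), Λ x * negSumRep Q J x : ℝ) =
      ∑ h : ZMod Q, (ZMod.stdAddChar h : ℂ) * T h ^ 2 * S h := by
    push_cast
    simp_rw [hS, mul_sum]
    rw [sum_comm]
    refine sum_congr rfl fun x _ ↦ ?_
    rw [mul_left_comm, mul_negSumRep, mul_sum]
    exact sum_congr rfl fun h _ ↦ by simp only [hT]; ring
  have hzero : (ZMod.stdAddChar (0 : ZMod Q) : ℂ) * T 0 ^ 2 * S 0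
      = (J : ℂ) ^ 2 * (∑ x ∈ Ioc 0 (2 ^ n), Λ x : ℝ) := by
    simp [hT, hS]
  have hterm : ∀ h ∈ univ.erase (0 : ZMod Q),
      ‖(ZMod.stdAddChar h : ℂ) * T h ^ 2 * S h‖ ≤ ‖T h‖ ^ 2 * E := by
    intro h hh
    have hh0 : h ≠ 0 := (mem_erase.1 hh).1
    have hz1 : (ZMod.stdAddChar h : ℂ) ≠ 1 := by
      intro hz
      apply hh0
      apply ZMod.injective_stdAddChar
      simp [hz]
    have hzQ : (ZMod.stdAddChar h : ℂ) ^ Q = 1 := by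
      rw [← stdAddChar_mul_natCast]; simp
    have hn1 : ‖(ZMod.stdAddChar h : ℂ)‖ = 1 :=
      Complex.norm_eq_one_of_pow_eq_one hzQ (NeZero.ne Q)
    rw [norm_mul, norm_mul, norm_pow, hn1, one_mul]
    by_cases hTh : T h = 0
    · simp [hTh]
    gcongr
    set q := orderOf (ZMod.stdAddChar h : ℂ) with hq
    have hqQ : q ∣ 2 ^ K := orderOf_dvd_of_pow_eq_one hzQ
    have hq0 : 0 < q := Nat.pos_of_dvd_of_pos hqQ (by positivity)
    refine (norm_sum_vonMangoldt_mul_pow_le hq0 (IsPrimitiveRoot.orderOf _)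
      (Nat.le_of_dvd (by positivity) hqQ) hK).trans ?_
    obtain ⟨a, ha, hqa⟩ := (Nat.dvd_prime_pow Nat.prime_two).1 hqQ
    have hka : k ≤ a := by
      by_contra! hlt
      apply hTh
      have h1 : q ∣ J := hqa ▸ pow_dvd_pow 2 hlt.le
      have h2 := mul_geom_sum (ZMod.stdAddChar h : ℂ) J
      rw [orderOf_dvd_iff_pow_eq_one.1 h1, sub_self] at h2
      exact (mul_eq_zero.1 h2).resolve_left (sub_ne_zero.2 hz1)
    have h3 : (2 : ℝ) ^ k ≤ q := by
      rw [hqa]; push_cast; exact pow_le_pow_right₀ (by norm_num) hka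
    rw [hE]
    gcongr
  have hdiff : ‖(Q : ℂ) * (∑ x ∈ Ioc 0 (2 ^ n), Λ x * negSumRep Q J x : ℝ)
      - (J : ℂ) ^ 2 * (∑ x ∈ Ioc 0 (2 ^ n), Λ x : ℝ)‖ ≤ Q * J * E := by
    rw [hexp, ← hzero, ← add_sum_erase _ _ (mem_univ (0 : ZMod Q)), add_sub_cancel_left]
    refine (norm_sum_le _ _).trans ((sum_le_sum hterm).trans ?_)
    rw [← sum_mul, ← sum_norm_sq_geom_stdAddChar hJQ]
    gcongr
    exact erase_subset _ _
  have hQ0 : (0 : ℝ) < Q := by exact_mod_cast (NeZero.pos Q)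
  rw [← mul_le_mul_iff_right₀ hQ0, ← abs_of_pos hQ0, ← abs_mul, abs_of_pos hQ0]
  have e1 : (Q : ℝ) * (∑ x ∈ Ioc 0 (2 ^ n), Λ x * negSumRep Q J x
      - 2 ^ (2 * k) / 2 ^ K * ∑ x ∈ Ioc 0 (2 ^ n), Λ x)
      = Q * (∑ x ∈ Ioc 0 (2 ^ n), Λ x * negSumRep Q J x)
        - (J : ℝ) ^ 2 * ∑ x ∈ Ioc 0 (2 ^ n), Λ x := by
    rw [hQ, hJ]; push_cast
    rw [mul_sub, ← mul_assoc, mul_div_cancel₀ _ (by positivity), pow_mul']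
  rw [e1, ← Real.norm_eq_abs, ← Complex.norm_real]
  push_cast at hdiff ⊢
  refine hdiff.trans (le_of_eq ?_)
  rw [hJ]; push_cast; ring

open ArithmeticFunction in
theorem psi_le_card_primes_mod_ge {n K k r : ℕ} (hn : 2 ≤ n) (hK : k + r + 1 = K)
    (hKn : 10 * K ≤ n) :
    Chebyshev.psi ((2 ^ n : ℕ) : ℝ) / 2 ^ (r + 1) - 12 * n ^ 2 * 2 ^ n / √(2 ^ k)
        - 2 * √(2 ^ n) * n ≤
      n * #{p ∈ range (2 ^ n) | p.Prime ∧ 2 ^ K - 2 ^ (K - r) ≤ p % 2 ^ K} := by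
  set N := 2 ^ n with hN
  set P : ℕ → Prop := fun x ↦ 2 ^ K - 2 ^ (K - r) ≤ x % 2 ^ K with hP
  have hJ : 2 * 2 ^ k = 2 ^ (K - r) := by
    rw [← pow_succ', ← hK]; congr 1; lia
  have hpsi : Chebyshev.psi (N : ℝ) = ∑ x ∈ Ioc 0 N, Λ x := by
    rw [Chebyshev.psi, Nat.floor_natCast]
  have h1 := (abs_le.1 (abs_sum_vonMangoldt_mul_negSumRep_sub_le (n := n) (K := K) (k := k)
    (by lia) hKn)).1
  rw [← hN, ← hpsi] at h1
  have h2 : ∑ x ∈ Ioc 0 N, Λ x * negSumRep (2 ^ K) (2 ^ k) x ≤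
      2 ^ k * ∑ x ∈ Ioc 0 N with P x, Λ x := by
    rw [mul_sum, sum_filter]
    refine sum_le_sum fun x _ ↦ ?_
    split_ifs with hx
    · rw [mul_comm]
      refine mul_le_mul_of_nonneg_right ?_ vonMangoldt_nonneg
      exact_mod_cast negSumRep_le (2 ^ K) (Nat.pow_le_pow_right (by simp) (by lia)) x
    · have : negSumRep (2 ^ K) (2 ^ k) x = 0 := by
        by_contra h0
        apply hx
        have := le_mod_of_negSumRep_ne_zero
          (by rw [hJ]; exact Nat.pow_le_pow_right (by simp) (by lia)) h0
        rwa [hJ] at this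
      simp [this]
  have hlogN : Real.log (N : ℝ) ≤ n := log_two_pow_le n
  have h3 : ∑ x ∈ Ioc 0 N with P x, Λ x ≤
      n * #{p ∈ range N | p.Prime ∧ P p} + 2 * √(2 ^ n) * n := by
    rw [← sum_filter_add_sum_filter_not (filter P (Ioc 0 N)) Nat.Prime]
    refine add_le_add ?_ ?_
    · rw [mul_comm, ← nsmul_eq_mul]
      refine (sum_le_card_nsmul _ _ (n : ℝ) fun p hp ↦ ?_).trans ?_
      · simp only [mem_filter, mem_Ioc] at hp
        rw [vonMangoldt_apply_prime hp.2]
        refine (Real.log_le_log (by exact_mod_cast hp.1.1.1) ?_).trans hlogN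
        exact_mod_cast hp.1.1.2
      · rw [nsmul_eq_mul, nsmul_eq_mul]
        gcongr
        intro p hp
        simp only [mem_filter, mem_Ioc, mem_range] at hp ⊢
        refine ⟨lt_of_le_of_ne hp.1.1.2 fun h ↦ ?_, hp.2, hp.1.2⟩
        exact Nat.Prime.not_prime_pow hn (h ▸ hp.2)
    · have h4 := Chebyshev.psi_sub_theta_le (x := (N : ℝ))
        (by exact_mod_cast Nat.one_le_two_pow)
      rw [Chebyshev.psi_sub_theta_eq_sum_not_prime, Nat.floor_natCast] at h4
      refine (sum_le_sum_of_subset_of_nonneg (filter_subset_filter _ (filter_subset _ _))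
        fun _ _ _ ↦ vonMangoldt_nonneg).trans (h4.trans ?_)
      have : ((N : ℕ) : ℝ) = 2 ^ n := by rw [hN]; push_cast; rfl
      rw [this] at hlogN ⊢
      gcongr
  have h5 : (2 : ℝ) ^ (2 * k) / 2 ^ K = 2 ^ k / 2 ^ (r + 1) := by
    rw [div_eq_div_iff (by positivity) (by positivity), ← hK]; ring
  have hk0 : (0 : ℝ) < 2 ^ k := by positivity
  rw [h5] at h1
  refine le_of_mul_le_mul_left ?_ hk0
  have h6 := mul_le_mul_of_nonneg_left h3 hk0.le
  have e : (2 : ℝ) ^ k * (Chebyshev.psi (N : ℝ) / 2 ^ (r + 1)) =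
      2 ^ k / 2 ^ (r + 1) * Chebyshev.psi (N : ℝ) := by ring
  rw [mul_sub, mul_sub, e]
  linarith

theorem digitSum_two_mul_add {b : ℕ} (hb : b < 2) (x : ℕ) :
    digitSum (b + 2 * x) = b + digitSum x := by
  unfold digitSum
  rcases Nat.eq_zero_or_pos (b + 2 * x) with h | h
  · obtain ⟨rfl, rfl⟩ : b = 0 ∧ x = 0 := by lia
    simp
  · rw [Nat.digits_def' (by norm_num) h]
    rw [show (b + 2 * x) % 2 = b by lia, show (b + 2 * x) / 2 = x by lia]
    simp

theorem digitSum_add_two_pow_mul {m a : ℕ} (ha : a < 2 ^ m) (b : ℕ) :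
    digitSum (a + 2 ^ m * b) = digitSum a + digitSum b := by
  induction m generalizing a with
  | zero =>
    obtain rfl : a = 0 := by simpa using ha
    simp [digitSum]
  | succ m ih =>
    have h1 : a = a % 2 + 2 * (a / 2) := (Nat.mod_add_div a 2).symm
    have h2 : a + 2 ^ (m + 1) * b = a % 2 + 2 * (a / 2 + 2 ^ m * b) := by
      rw [mul_add, ← add_assoc, ← h1]; ring
    rw [h2, digitSum_two_mul_add (by lia), ih (by rw [pow_succ] at ha; lia)]
    conv_rhs => rw [h1, digitSum_two_mul_add (by lia)]
    ring

theorem digitSum_two_pow_sub_one (r : ℕ) : digitSum (2 ^ r - 1) = r := by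
  induction r with
  | zero => simp [digitSum]
  | succ r ih =>
    have : 2 ^ (r + 1) - 1 = 1 + 2 * (2 ^ r - 1) := by
      have := Nat.one_le_two_pow (n := r)
      rw [pow_succ]; lia
    rw [this, digitSum_two_mul_add (by lia), ih, add_comm]

theorem sum_range_pow_digitSum (w : ℝ) (m : ℕ) :
    ∑ a ∈ range (2 ^ m), w ^ digitSum a = (1 + w) ^ m := by
  induction m with
  | zero => simp [digitSum]
  | succ m ih =>
    rw [pow_succ 2 m, mul_two, sum_range_add, pow_succ (1 + w), mul_add, mul_one, ih]
    congr 1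
    rw [← ih, sum_mul]
    refine sum_congr rfl fun a ha ↦ ?_
    have := digitSum_add_two_pow_mul (mem_range.1 ha) 1
    rw [mul_one] at this
    rw [add_comm, this, pow_add]
    simp [digitSum]

/-- The generating function of the digit sum over the `x < 2 ^ (a + r + b)` whose binary digits
in the positions from `a` to `a + r - 1` all equal one. -/
theorem sum_pow_digitSum_filter_mod_ge (w : ℝ) (a r b : ℕ) :
    ∑ x ∈ range (2 ^ (a + r + b)) with 2 ^ (a + r) - 2 ^ a ≤ x % 2 ^ (a + r), w ^ digitSum x =
      w ^ r * (1 + w) ^ (a + b) := by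
  have key : ∑ y ∈ range (2 ^ a) ×ˢ range (2 ^ b), w ^ (digitSum y.1 + (r + digitSum y.2)) =
      w ^ r * (1 + w) ^ (a + b) := by
    rw [pow_add (1 + w), ← sum_range_pow_digitSum, ← sum_range_pow_digitSum, sum_mul_sum,
      ← sum_product', mul_sum]
    exact sum_congr rfl fun y _ ↦ by ring
  rw [← key]
  have hpos : 0 < 2 ^ (a + r) := by positivity
  have hle : 2 ^ a ≤ 2 ^ (a + r) := Nat.pow_le_pow_right (by simp) (by lia)
  refine (sum_nbij' (fun y ↦ y.1 + (2 ^ (a + r) - 2 ^ a) + 2 ^ (a + r) * y.2)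
    (fun x ↦ (x % 2 ^ (a + r) - (2 ^ (a + r) - 2 ^ a), x / 2 ^ (a + r))) ?_ ?_ ?_ ?_ ?_).symm
  · rintro ⟨u, v⟩ hy
    simp only [mem_product, mem_range, mem_filter] at hy ⊢
    have hlt : u + (2 ^ (a + r) - 2 ^ a) < 2 ^ (a + r) := by lia
    refine ⟨?_, ?_⟩
    · rw [pow_add 2 (a + r) b]
      calc _ < 2 ^ (a + r) * (v + 1) := by rw [mul_add, mul_one]; lia
        _ ≤ _ := Nat.mul_le_mul_left _ hy.2
    · rw [Nat.add_mul_mod_self_left, Nat.mod_eq_of_lt hlt]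
      lia
  · intro x hx
    simp only [mem_product, mem_range, mem_filter] at hx ⊢
    have := Nat.mod_lt x hpos
    refine ⟨by lia, ?_⟩
    rw [Nat.div_lt_iff_lt_mul hpos, mul_comm, ← pow_add]
    exact hx.1
  · rintro ⟨u, v⟩ hy
    simp only [mem_product, mem_range] at hy ⊢
    have hlt : u + (2 ^ (a + r) - 2 ^ a) < 2 ^ (a + r) := by lia
    rw [Nat.add_mul_mod_self_left, Nat.mod_eq_of_lt hlt, Nat.add_mul_div_left _ _ hpos,
      Nat.div_eq_of_lt hlt]
    simp
  · intro x hx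
    simp only [mem_range, mem_filter] at hx
    rw [Nat.sub_add_cancel hx.2, Nat.mod_add_div]
  · rintro ⟨u, v⟩ hy
    simp only [mem_product, mem_range] at hy ⊢
    have hlt : u + (2 ^ (a + r) - 2 ^ a) < 2 ^ (a + r) := by lia
    have h1 : u + (2 ^ (a + r) - 2 ^ a) = u + 2 ^ a * (2 ^ r - 1) := by
      rw [Nat.mul_sub, mul_one, pow_add]
    rw [digitSum_add_two_pow_mul hlt, h1, digitSum_add_two_pow_mul hy.1,
      digitSum_two_pow_sub_one, add_assoc]

theorem card_digitSum_le_filter_mod_ge_le {n K r : ℕ} (hr : r ≤ K) (hK : K ≤ n) (hn : 0 < n) :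
    (#{x ∈ range (2 ^ n) | 2 ^ K - 2 ^ (K - r) ≤ x % 2 ^ K ∧ 6 * digitSum x ≤ 3 * n + 2 * r} : ℝ) ≤
      2 ^ (n - r) * Real.exp (-(r ^ 2 / (18 * n))) := by
  obtain ⟨a, rfl⟩ : ∃ a, K = a + r := ⟨K - r, by lia⟩
  obtain ⟨b, rfl⟩ : ∃ b, n = a + r + b := ⟨n - (a + r), by lia⟩
  set n := a + r + b with hnd
  have hn' : (0 : ℝ) < n := by exact_mod_cast hn
  set t : ℝ := 2 * r / (3 * n) with ht
  have ht0 : 0 ≤ t := by positivity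
  set w : ℝ := Real.exp (-t) with hw
  have h1 := sum_pow_digitSum_filter_mod_ge w a r b
  have hw1 : 1 + w ≤ 2 * Real.exp (-(t / 2) + t ^ 2 / 8) := by
    have h2 := Real.cosh_le_exp_half_sq (t / 2)
    have h3 : 1 + w = 2 * (Real.exp (-(t / 2)) * Real.cosh (t / 2)) := by
      rw [Real.cosh_eq, mul_div_assoc', mul_add, ← Real.exp_add, ← Real.exp_add, hw]
      ring_nf
      rw [Real.exp_zero, add_comm]
    rw [h3, Real.exp_add]
    gcongr
    exact h2.trans (le_of_eq (by ring_nf))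
  have hcount : (#{x ∈ range (2 ^ n) | 2 ^ (a + r) - 2 ^ (a + r - r) ≤ x % 2 ^ (a + r) ∧
      6 * digitSum x ≤ 3 * n + 2 * r} : ℝ) ≤
      Real.exp (t * (n / 2 + r / 3)) * (w ^ r * (1 + w) ^ (a + b)) := by
    rw [← h1, mul_sum, card_eq_sum_ones, Nat.cast_sum, Nat.cast_one, Nat.add_sub_cancel]
    refine (sum_le_sum fun x hx ↦ ?_).trans (sum_le_sum_of_subset_of_nonneg
      (monotone_filter_right _ fun x _ hx ↦ hx.1) fun _ _ _ ↦ by positivity)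
    simp only [mem_filter] at hx
    rw [hw, ← Real.exp_nat_mul, ← Real.exp_add, Real.one_le_exp_iff]
    have : 6 * (digitSum x : ℝ) ≤ 3 * n + 2 * r := by exact_mod_cast hx.2.2
    nlinarith
  refine hcount.trans ?_
  have hm : n - r = a + b := by lia
  have hm' : ((a + b : ℕ) : ℝ) + r = n := by rw [hnd]; push_cast; ring
  calc _ ≤ Real.exp (t * (n / 2 + r / 3)) *
        (w ^ r * (2 * Real.exp (-(t / 2) + t ^ 2 / 8)) ^ (a + b)) := by
        have : 0 ≤ 1 + w := by positivity
        gcongr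
    _ = 2 ^ (n - r) * Real.exp (t * (n / 2 + r / 3) + (r * -t +
        (a + b : ℕ) * (-(t / 2) + t ^ 2 / 8))) := by
        rw [hw, mul_pow, ← Real.exp_nat_mul, ← Real.exp_nat_mul, hm, Real.exp_add, Real.exp_add]
        ring
    _ ≤ _ := by
        gcongr
        have hmn : ((a + b : ℕ) : ℝ) ≤ n := by rw [← hm']; simp
        have h2 : -(r ^ 2 / (18 * n) : ℝ) = -(t * r / 6) + n * (t ^ 2 / 8) := by
          rw [ht]; field_simp; ring
        have h3 := mul_le_mul_of_nonneg_right hmn (show 0 ≤ t ^ 2 / 8 by positivity)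
        have h4 : (r : ℝ) = n - (a + b : ℕ) := by rw [← hm']; ring
        rw [h2]
        linear_combination h3 + (-t/2) * h4

theorem card_primes_mod_ge_ge {n r : ℕ} (hn : 10000 ≤ n) (hr : 400 * r ≤ n)
    (hpow : n ^ 4 ≤ 2 ^ (n / 100)) :
    2 ^ n / (8 * 2 ^ r) ≤ (n : ℝ) *
      #{p ∈ range (2 ^ n) | p.Prime ∧ 2 ^ (n / 10) - 2 ^ (n / 10 - r) ≤ p % 2 ^ (n / 10)} := by
  obtain ⟨k, hk⟩ : ∃ k, k + r + 1 = n / 10 := ⟨n / 10 - r - 1, by lia⟩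
  refine le_trans ?_ (psi_le_card_primes_mod_ge (by lia) hk (by lia))
  have hpow' : (n : ℝ) ^ 4 ≤ 2 ^ (n / 100) := by exact_mod_cast hpow
  have hn' : (10000 : ℝ) ≤ n := by exact_mod_cast hn
  have h1 : 12 * (n : ℝ) ^ 2 * 2 ^ (r + 4) ≤ √(2 ^ k) := by
    apply Real.le_sqrt_of_sq_le
    calc (12 * (n : ℝ) ^ 2 * 2 ^ (r + 4)) ^ 2 = 144 * n ^ 4 * 2 ^ (2 * (r + 4)) := by ring
      _ ≤ 2 ^ 8 * 2 ^ (n / 100) * 2 ^ (2 * (r + 4)) := by gcongr; norm_num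
      _ = 2 ^ (8 + n / 100 + 2 * (r + 4)) := by rw [← pow_add, ← pow_add]
      _ ≤ 2 ^ k := pow_le_pow_right₀ (by norm_num) (by lia)
  have h2 : (n : ℝ) * 2 ^ (r + 5) ≤ √(2 ^ n) := by
    apply Real.le_sqrt_of_sq_le
    calc ((n : ℝ) * 2 ^ (r + 5)) ^ 2 = (n : ℝ) ^ 2 * 2 ^ (2 * (r + 5)) := by ring
      _ ≤ (n : ℝ) ^ 4 * 2 ^ (2 * (r + 5)) := by gcongr <;> linarith
      _ ≤ 2 ^ (n / 100) * 2 ^ (2 * (r + 5)) := by gcongr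
      _ = 2 ^ (n / 100 + 2 * (r + 5)) := by rw [← pow_add]
      _ ≤ 2 ^ n := pow_le_pow_right₀ (by norm_num) (by lia)
  have h3 : (2 : ℝ) ^ n / 2 ≤ Chebyshev.psi ((2 ^ n : ℕ) : ℝ) := by
    refine le_trans ?_ (Chebyshev.psi_ge (2 ^ n))
    have hlog : Real.log (((2 ^ n : ℕ) : ℝ) + 1) ≤ n + 1 := by
      refine (Real.log_le_log (by positivity) ?_).trans
        ((log_two_pow_le (n + 1)).trans (by push_cast; rfl))
      have : (1 : ℝ) ≤ 2 ^ n := one_le_pow₀ (by norm_num)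
      push_cast
      rw [pow_succ]
      linarith
    have h4 : (n : ℝ) ^ 4 ≤ 2 ^ n :=
      hpow'.trans (pow_le_pow_right₀ (by norm_num) (by lia))
    have h5 : (n : ℝ) * 1000 ≤ n ^ 4 := by
      rw [pow_succ' (n : ℝ) 3]
      gcongr
      nlinarith
    have := Real.log_two_gt_d9
    push_cast at hlog ⊢
    nlinarith
  have e1 : 12 * n ^ 2 * 2 ^ n / √(2 ^ k) ≤ (2 : ℝ) ^ n / 2 ^ (r + 4) := by
    rw [div_le_div_iff₀ (by positivity) (by positivity)]
    calc _ = (2 : ℝ) ^ n * (12 * n ^ 2 * 2 ^ (r + 4)) := by ring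
      _ ≤ _ := by gcongr
  have e2 : 2 * √(2 ^ n) * n ≤ (2 : ℝ) ^ n / 2 ^ (r + 4) := by
    rw [le_div_iff₀ (by positivity)]
    calc _ = √(2 ^ n) * ((n : ℝ) * 2 ^ (r + 5)) := by ring
      _ ≤ √(2 ^ n) * √(2 ^ n) := by gcongr
      _ = 2 ^ n := Real.mul_self_sqrt (by positivity)
  have e3 : (2 : ℝ) ^ n / 2 / 2 ^ (r + 1) ≤ Chebyshev.psi ((2 ^ n : ℕ) : ℝ) / 2 ^ (r + 1) := by
    gcongr
  have e4 : (2 : ℝ) ^ n / (8 * 2 ^ r) =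
      2 ^ n / 2 / 2 ^ (r + 1) - 2 ^ n / 2 ^ (r + 4) - 2 ^ n / 2 ^ (r + 4) := by
    rw [pow_add _ r 1, pow_add _ r 4]
    field_simp
    norm_num
  linarith

theorem card_primes_digitSum_gt_ge {n r : ℕ} (hn : 10000 ≤ n) (hr : 400 * r ≤ n)
    (hpow : n ^ 4 ≤ 2 ^ (n / 100)) (hexp : 16 * n ≤ Real.exp (r ^ 2 / (18 * n))) :
    2 ^ n / (16 * 2 ^ r) ≤ (n : ℝ) *
      #{p ∈ range (2 ^ n) | p.Prime ∧ 3 * n + 2 * r < 6 * digitSum p} := by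
  have h1 := card_primes_mod_ge_ge hn hr hpow
  have h2 := card_digitSum_le_filter_mod_ge_le (n := n) (K := n / 10) (r := r) (by lia) (by lia)
    (by lia)
  have hn' : (0 : ℝ) < n := by exact_mod_cast (show 0 < n by lia)
  have h3 : (n : ℝ) * (2 ^ (n - r) * Real.exp (-(r ^ 2 / (18 * n)))) ≤ 2 ^ n / (16 * 2 ^ r) := by
    rw [pow_sub₀ _ (by norm_num) (by lia), Real.exp_neg, ← div_eq_mul_inv, ← div_eq_mul_inv]
    rw [div_div, mul_div_assoc', div_le_div_iff₀ (by positivity) (by positivity)]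
    have : (0 : ℝ) ≤ 2 ^ n * 2 ^ r := by positivity
    nlinarith [mul_le_mul_of_nonneg_left hexp this]
  have h4 : (#{p ∈ range (2 ^ n) | p.Prime ∧
      2 ^ (n / 10) - 2 ^ (n / 10 - r) ≤ p % 2 ^ (n / 10)} : ℝ) ≤
      #{p ∈ range (2 ^ n) | p.Prime ∧ 3 * n + 2 * r < 6 * digitSum p} +
      #{x ∈ range (2 ^ n) | 2 ^ (n / 10) - 2 ^ (n / 10 - r) ≤ x % 2 ^ (n / 10) ∧
        6 * digitSum x ≤ 3 * n + 2 * r} := by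
    norm_cast
    refine (card_le_card fun p hp ↦ ?_).trans (card_union_le _ _)
    simp only [mem_union, mem_filter] at hp ⊢
    rcases le_or_gt (6 * digitSum p) (3 * n + 2 * r) with h | h
    · exact Or.inr ⟨hp.1, hp.2.2, h⟩
    · exact Or.inl ⟨hp.1, hp.2.1, h⟩
  have h5 := mul_le_mul_of_nonneg_left (h4.trans (add_le_add_right h2 _)) hn'.le
  have h6 : (2 : ℝ) ^ n / (8 * 2 ^ r) = 2 ^ n / (16 * 2 ^ r) + 2 ^ n / (16 * 2 ^ r) := by
    field_simp; norm_num
  rw [mul_add] at h5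
  linarith

open Filter in
theorem eventually_pow_four_le_two_pow_div :
    ∀ᶠ n : ℕ in atTop, n ^ 4 ≤ 2 ^ (n / 100) := by
  have h1 := tendsto_pow_const_div_const_pow_of_one_lt 4 (one_lt_two (α := ℝ))
  have h2 : ∀ᶠ m : ℕ in atTop, (200 * m) ^ 4 ≤ 2 ^ m := by
    filter_upwards [h1.eventually_le_const (show (0 : ℝ) < 1 / 200 ^ 4 by norm_num)] with m hm
    rw [div_le_div_iff₀ (by positivity) (by positivity)] at hm
    have : (200 * m : ℝ) ^ 4 ≤ 2 ^ m := by rw [mul_pow]; linarith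
    exact_mod_cast this
  filter_upwards [(Nat.tendsto_div_const_atTop (show 100 ≠ 0 by norm_num)).eventually h2,
    eventually_ge_atTop 100] with n hn h100
  exact (Nat.pow_le_pow_left (by lia) 4).trans hn

open Filter in
theorem eventually_mul_ceil_rpow_le {ρ : ℝ} (hρ : ρ < 1) (C : ℕ) :
    ∀ᶠ n : ℕ in atTop, C * ⌈(n : ℝ) ^ ρ⌉₊ ≤ n := by
  have h1 : ∀ᶠ x : ℝ in atTop, C * (x ^ ρ + 1) ≤ x := by
    filter_upwards [(tendsto_rpow_atTop (sub_pos.2 hρ)).eventually_ge_atTop (2 * C : ℝ),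
      eventually_ge_atTop (2 * C : ℝ), eventually_gt_atTop 0] with x hx hx2 hx0
    have : (2 * C : ℝ) * x ^ ρ ≤ x := by
      calc (2 * C : ℝ) * x ^ ρ ≤ x ^ (1 - ρ) * x ^ ρ := by gcongr
        _ = x := by rw [← Real.rpow_add hx0, sub_add_cancel, Real.rpow_one]
    linarith
  filter_upwards [tendsto_natCast_atTop_atTop.eventually h1] with n hn
  have h3 := (Nat.ceil_lt_add_one (show 0 ≤ (n : ℝ) ^ ρ by positivity)).le
  have h4 : (C : ℝ) * ⌈(n : ℝ) ^ ρ⌉₊ ≤ n := le_trans (by gcongr) hn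
  exact_mod_cast h4

open Filter in
theorem eventually_mul_le_exp_ceil_rpow_sq_div {ρ : ℝ} (hρ : 1 / 2 < ρ) :
    ∀ᶠ n : ℕ in atTop, 16 * (n : ℝ) ≤ Real.exp ((⌈(n : ℝ) ^ ρ⌉₊ : ℝ) ^ 2 / (18 * n)) := by
  have hs : 0 < 2 * ρ - 1 := by linarith
  have h1 : ∀ᶠ x : ℝ in atTop, Real.log (16 * x) ≤ x ^ (2 * ρ - 1) / 18 := by
    filter_upwards [(isLittleO_log_rpow_atTop hs).bound (show (0 : ℝ) < 1 / 36 by norm_num),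
      (tendsto_rpow_atTop hs).eventually_ge_atTop (36 * Real.log 16),
      eventually_gt_atTop 0] with x hx hx2 hx0
    rw [Real.norm_of_nonneg (by positivity : (0 : ℝ) ≤ x ^ (2 * ρ - 1))] at hx
    rw [Real.log_mul (by norm_num) hx0.ne']
    have := (Real.le_norm_self _).trans hx
    linarith
  filter_upwards [tendsto_natCast_atTop_atTop.eventually h1, eventually_gt_atTop 0] with n hn hn0
  have hn' : (0 : ℝ) < n := by exact_mod_cast hn0
  rw [← Real.log_le_iff_le_exp (by positivity)]
  refine hn.trans ?_
  rw [Real.rpow_sub hn', Real.rpow_one, two_mul, Real.rpow_add hn', ← sq, div_div, mul_comm 18]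
  gcongr
  exact Nat.le_ceil _

/-- For every `ρ` with `1/2 < ρ < 4/7` there exist `c > 0` and `n₀` such that for every odd
integer `n ≥ n₀`, setting `N = 2^n` and `r = ⌈n^ρ⌉`, the number of primes `p < N` with binary
digit sum `s(p) > n/2 + r/3` is at least `c · 2^{−r} N / n`. -/
theorem primes_with_large_digit_sum (ρ : ℝ) (hρ₁ : 1 / 2 < ρ) (hρ₂ : ρ < 4 / 7) :
    ∃ c > (0 : ℝ), ∃ n₀ : ℕ, ∀ n : ℕ, n₀ ≤ n → Odd n →
      ∀ r : ℕ, r = ⌈(n : ℝ) ^ ρ⌉₊ →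
        c * (2 : ℝ) ^ (-(r : ℝ)) * (2 ^ n : ℝ) / n ≤
          ((Finset.range (2 ^ n)).filter
            (fun p => Nat.Prime p ∧ 3 * n + 2 * r < 6 * digitSum p)).card := by
  obtain ⟨n₀, hn₀⟩ := Filter.eventually_atTop.1 ((Filter.eventually_ge_atTop 10000).and
    (eventually_pow_four_le_two_pow_div.and
      ((eventually_mul_ceil_rpow_le (show ρ < 1 by linarith) 400).and
        (eventually_mul_le_exp_ceil_rpow_sq_div hρ₁))))
  refine ⟨1 / 16, by norm_num, n₀, fun n hn _ r hr ↦ ?_⟩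
  subst hr
  obtain ⟨h1, h2, h3, h4⟩ := hn₀ n hn
  have hn' : (0 : ℝ) < n := by exact_mod_cast (show 0 < n by lia)
  rw [div_le_iff₀' hn', Real.rpow_neg (by norm_num), Real.rpow_natCast]
  refine le_trans (le_of_eq ?_) (card_primes_digitSum_gt_ge h1 h3 h2 h4)
  field_simp
end

section
/- For every ρ with 1/2 < ρ < 4/7 there exist c > 0 and n₀ such that for every odd integer n ≥ n₀, setting N = 2^n and r = ⌈n^ρ⌉, the number of primes p < N whose binary digit sum satisfies s(p) < n/2 − r/3 is at least c · 2^{−r} N/n. -/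
open Finset

theorem digitSum_two_mul (x : ℕ) : digitSum (2 * x) = digitSum x := by
  rcases Nat.eq_zero_or_pos x with rfl | hx
  · rfl
  · simp [digitSum, Nat.digits_base_mul one_lt_two hx]

theorem digitSum_two_mul_add_one (x : ℕ) : digitSum (2 * x + 1) = digitSum x + 1 := by
  have h := Nat.digits_add_two_add_one 0 (2 * x)
  have h₁ : (2 * x + 1) % 2 = 1 := by omega
  have h₂ : (2 * x + 1) / 2 = x := by omega
  simp only [zero_add, h₁, h₂] at h
  rw [digitSum, h, List.sum_cons, add_comm, digitSum]

theorem sum_range_two_mul {M : Type*} [AddCommMonoid M] (f : ℕ → M) (k : ℕ) :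
    ∑ i ∈ range (2 * k), f i = ∑ i ∈ range k, (f (2 * i) + f (2 * i + 1)) := by
  induction k with
  | zero => simp
  | succ k ih =>
    rw [show 2 * (k + 1) = 2 * k + 1 + 1 by ring, sum_range_succ, sum_range_succ, ih,
      sum_range_succ, add_assoc]

/-- The generating function of the binary digit sum on `[0, 2 ^ m)`. -/
theorem sum_pow_digitSum (t : ℝ) (m : ℕ) :
    ∑ x ∈ range (2 ^ m), t ^ digitSum x = (1 + t) ^ m := by
  induction m with
  | zero => simp [digitSum]
  | succ m ih =>
    rw [pow_succ', sum_range_two_mul, pow_succ, ← ih, sum_mul]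
    refine sum_congr rfl fun x _ => ?_
    rw [digitSum_two_mul, digitSum_two_mul_add_one]
    ring

/-- Chernoff bound for the upper tail of the binary digit sum on `[0, 2 ^ m)`. -/
theorem card_le_digitSum_le (m : ℕ) {l : ℝ} (hl : 0 ≤ l) (a : ℝ) :
    (#{x ∈ range (2 ^ m) | (m : ℝ) / 2 + a ≤ digitSum x} : ℝ) ≤
      2 ^ m * Real.exp (m * l ^ 2 / 8 - l * a) := by
  have hcosh : 1 + Real.exp l = 2 * Real.exp (l / 2) * Real.cosh (l / 2) := by
    have h₁ : Real.exp l = Real.exp (l / 2) * Real.exp (l / 2) := by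
      rw [← Real.exp_add]; ring_nf
    have h₂ : Real.exp (l / 2) * Real.exp (-(l / 2)) = 1 := by
      rw [← Real.exp_add]; simp
    rw [Real.cosh_eq, h₁]
    linear_combination -h₂
  calc (#{x ∈ range (2 ^ m) | (m : ℝ) / 2 + a ≤ digitSum x} : ℝ)
      = ∑ x ∈ range (2 ^ m) with (m : ℝ) / 2 + a ≤ digitSum x, (1 : ℝ) := by simp
    _ ≤ ∑ x ∈ range (2 ^ m) with (m : ℝ) / 2 + a ≤ digitSum x,
          Real.exp l ^ digitSum x * Real.exp (-(l * (m / 2 + a))) := by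
        refine sum_le_sum fun x hx => ?_
        rw [← Real.exp_nat_mul, ← Real.exp_add]
        refine Real.one_le_exp ?_
        nlinarith [mul_le_mul_of_nonneg_left (mem_filter.1 hx).2 hl]
    _ ≤ ∑ x ∈ range (2 ^ m), Real.exp l ^ digitSum x * Real.exp (-(l * (m / 2 + a))) :=
        sum_le_sum_of_subset_of_nonneg (filter_subset _ _) fun _ _ _ => by positivity
    _ = 2 ^ m * Real.cosh (l / 2) ^ m * Real.exp (-(l * a)) := by
        rw [← sum_mul, sum_pow_digitSum, hcosh, mul_pow, mul_pow, ← Real.exp_nat_mul]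
        have : Real.exp (-(l * (m / 2 + a))) = Real.exp (-(m * (l / 2))) * Real.exp (-(l * a)) := by
          rw [← Real.exp_add]; ring_nf
        rw [this, Real.exp_neg (m * (l / 2))]
        field_simp
    _ ≤ 2 ^ m * Real.exp ((l / 2) ^ 2 / 2) ^ m * Real.exp (-(l * a)) := by
        gcongr
        exact Real.cosh_le_exp_half_sq _
    _ = 2 ^ m * Real.exp (m * l ^ 2 / 8 - l * a) := by
        rw [← Real.exp_nat_mul, mul_assoc, ← Real.exp_add]
        ring_nf

/-- Chebyshev's lower bound at powers of two. -/
theorem le_card_primes_lt_two_pow {m : ℕ} (hm : 3 ≤ m) :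
    (2 : ℝ) ^ m / (2 * m) ≤ #{p ∈ range (2 ^ m) | p.Prime} := by
  have hpow : 2 * (m + 1) ≤ 2 ^ m := by
    induction m, hm using Nat.le_induction with
    | base => norm_num
    | succ k hk ih => rw [pow_succ]; omega
  have hcard : #{p ∈ range (2 ^ m) | p.Prime} = Nat.primeCounting (2 ^ m) := by
    rw [Nat.primeCounting, Nat.primeCounting', Nat.count_succ, Nat.count_eq_card_filter_range,
      if_neg (Nat.Prime.not_prime_pow (by omega)), add_zero]
  have hlog : Real.log (2 ^ m + 1) ≤ (m + 1 : ℕ) * Real.log 2 := by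
    rw [← Real.log_pow]
    refine Real.log_le_log (by positivity) ?_
    rw [pow_succ]
    linarith [one_le_pow₀ (M₀ := ℝ) one_le_two (n := m)]
  have hpow' : 2 * ((m : ℝ) + 1) ≤ 2 ^ m := by exact_mod_cast hpow
  have h2 : 0 < Real.log 2 := Real.log_pos one_lt_two
  have hm0 : (0 : ℝ) < m := by positivity
  have h := Chebyshev.pi_ge (2 ^ m)
  rw [hcard]
  refine le_trans ?_ h
  push_cast at hlog ⊢
  rw [Real.log_pow, div_le_div_iff₀ (by positivity) (by positivity)]
  have : 2 ^ m * Real.log 2 ≤ 2 * (2 ^ m * Real.log 2 - Real.log (2 ^ m + 1)) := by nlinarith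
  nlinarith

/-- Stretched exponential decay beats any polynomial. -/
theorem eventually_exp_neg_rpow_le {δ : ℝ} (hδ : 0 < δ) :
    ∀ᶠ n : ℕ in Filter.atTop, Real.exp (1 / 8 - (n : ℝ) ^ δ / 6) ≤ 1 / (4 * n) := by
  have hlog := (isLittleO_log_rpow_atTop hδ).bound (show (0 : ℝ) < 1 / 12 by norm_num)
  have hbig := (tendsto_rpow_atTop hδ).eventually_ge_atTop (12 * (1 / 8 + Real.log 4))
  filter_upwards [tendsto_natCast_atTop_atTop.eventually hlog,
    tendsto_natCast_atTop_atTop.eventually hbig, Filter.eventually_gt_atTop 0] with n h₁ h₂ h₃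
  have hn : (0 : ℝ) < n := by exact_mod_cast h₃
  rw [Real.norm_eq_abs, Real.norm_of_nonneg (Real.rpow_nonneg hn.le _)] at h₁
  rw [← Real.le_log_iff_exp_le (by positivity), one_div (4 * (n : ℝ)), Real.log_inv,
    Real.log_mul four_ne_zero hn.ne']
  linarith [le_abs_self (Real.log n)]

theorem eventually_ceil_rpow_add_three_le {ρ : ℝ} (hρ : ρ < 1) :
    ∀ᶠ n : ℕ in Filter.atTop, ⌈(n : ℝ) ^ ρ⌉₊ + 3 ≤ n := by
  have hbig := (tendsto_rpow_atTop (sub_pos.2 hρ)).eventually_ge_atTop 2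
  filter_upwards [tendsto_natCast_atTop_atTop.eventually hbig,
    Filter.eventually_ge_atTop 8] with n h₁ h₂
  have hn : (8 : ℝ) ≤ n := by exact_mod_cast h₂
  have hmul : (n : ℝ) ^ ρ * (n : ℝ) ^ (1 - ρ) = n := by
    rw [← Real.rpow_add (by linarith), add_sub_cancel, Real.rpow_one]
  have hpos : 0 ≤ (n : ℝ) ^ ρ := by positivity
  have hceil := Nat.ceil_lt_add_one hpos
  have : (⌈(n : ℝ) ^ ρ⌉₊ : ℝ) + 3 ≤ n := by nlinarith
  exact_mod_cast this

/-- For every `ρ` with `1/2 < ρ < 4/7` there exist `c > 0` and `n₀` such that for every odd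
integer `n ≥ n₀`, setting `N = 2^n` and `r = ⌈n^ρ⌉`, the number of primes `p < N` with binary
digit sum `s(p) < n/2 − r/3` is at least `c · 2^{−r} N / n`. -/
theorem primes_with_small_digit_sum (ρ : ℝ) (hρ₁ : 1 / 2 < ρ) (hρ₂ : ρ < 4 / 7) :
    ∃ c > (0 : ℝ), ∃ n₀ : ℕ, ∀ n : ℕ, n₀ ≤ n → Odd n →
      ∀ r : ℕ, r = ⌈(n : ℝ) ^ ρ⌉₊ →
        c * (2 : ℝ) ^ (-(r : ℝ)) * (2 ^ n : ℝ) / n ≤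
          ((Finset.range (2 ^ n)).filter
            (fun p => Nat.Prime p ∧ 6 * digitSum p + 2 * r < 3 * n)).card := by
  obtain ⟨n₀, hn₀⟩ := Filter.eventually_atTop.1
    ((eventually_exp_neg_rpow_le (sub_pos.2 hρ₁)).and
      (eventually_ceil_rpow_add_three_le (ρ := ρ) (by linarith)))
  refine ⟨1 / 4, by norm_num, n₀, fun n hn _ r hr => ?_⟩
  obtain ⟨hexp, hrn⟩ := hn₀ n hn
  rw [← hr] at hrn
  obtain ⟨m, rfl⟩ : ∃ m, n = m + r := ⟨n - r, by omega⟩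
  have hm : 3 ≤ m := by omega
  set n := m + r with hn_def
  have hm0 : (0 : ℝ) < m := by positivity
  have hnpos : (0 : ℝ) < n := by positivity
  have hmn : (m : ℝ) ≤ n := by exact_mod_cast Nat.le_add_right m r
  have hpow : (2 : ℝ) ^ (-(r : ℝ)) * 2 ^ n = 2 ^ m := by
    rw [Real.rpow_neg zero_le_two, Real.rpow_natCast, hn_def, pow_add]
    field_simp
  have hsplit : #{p ∈ range (2 ^ m) | p.Prime} ≤
      #{p ∈ range (2 ^ n) | p.Prime ∧ 6 * digitSum p + 2 * r < 3 * n} +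
        #{x ∈ range (2 ^ m) | (m : ℝ) / 2 + r / 6 ≤ digitSum x} := by
    refine (card_le_card fun p hp => ?_).trans (card_union_le _ _)
    rw [mem_filter, mem_range] at hp
    rw [mem_union, mem_filter, mem_filter, mem_range, mem_range]
    rcases lt_or_ge (6 * digitSum p + 2 * r) (3 * n) with h | h
    · exact Or.inl ⟨hp.1.trans_le (Nat.pow_le_pow_right two_pos (Nat.le_add_right m r)), hp.2, h⟩
    · refine Or.inr ⟨hp.1, ?_⟩
      have : 3 * ((m : ℝ) + r) ≤ 6 * digitSum p + 2 * r := by exact_mod_cast h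
      linarith
  have htail : (#{x ∈ range (2 ^ m) | (m : ℝ) / 2 + r / 6 ≤ digitSum x} : ℝ) ≤
      2 ^ m * (1 / (4 * n)) := by
    have hs : 0 < √(n : ℝ) := Real.sqrt_pos.2 hnpos
    refine (card_le_digitSum_le m (l := 1 / √(n : ℝ)) (by positivity) _).trans ?_
    refine mul_le_mul_of_nonneg_left (le_trans (Real.exp_le_exp.2 ?_) hexp) (by positivity)
    have h₁ : (m : ℝ) * (1 / √(n : ℝ)) ^ 2 / 8 ≤ 1 / 8 := by
      rw [div_pow, Real.sq_sqrt hnpos.le, one_pow, mul_one_div]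
      linarith [(div_le_one hnpos).2 hmn]
    have h₂ : (n : ℝ) ^ (ρ - 1 / 2) ≤ 1 / √(n : ℝ) * r := by
      rw [Real.rpow_sub hnpos, ← Real.sqrt_eq_rpow, one_div_mul_eq_div]
      gcongr
      exact hr ▸ Nat.le_ceil _
    linarith
  have hsplit' : (#{p ∈ range (2 ^ m) | p.Prime} : ℝ) ≤
      #{p ∈ range (2 ^ n) | p.Prime ∧ 6 * digitSum p + 2 * r < 3 * n} +
        #{x ∈ range (2 ^ m) | (m : ℝ) / 2 + r / 6 ≤ digitSum x} := by exact_mod_cast hsplit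
  have hprimes : (2 : ℝ) ^ m / (2 * n) ≤ #{p ∈ range (2 ^ m) | p.Prime} :=
    le_trans (by gcongr) (le_card_primes_lt_two_pow hm)
  have hhalf : (2 : ℝ) ^ m / (2 * n) = 2 * (2 ^ m * (1 / (4 * n))) := by field_simp; norm_num
  have hgoal : 1 / 4 * (2 : ℝ) ^ (-(r : ℝ)) * 2 ^ n / n = 2 ^ m * (1 / (4 * n)) := by
    rw [mul_assoc, hpow]; field_simp
  rw [hgoal]
  linarith
end

section
/- Let α be a real number, M a positive integer, T > 0, and δ a real number with 2/M < δ ≤ 1. If the number of integers x with M ≤ x < 2M and ‖xα‖ < T exceeds δM, then there exist coprime integers a and q with 1 ≤ q ≤ 2/δ such that |α − a/q| ≤ 2T/q. -/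
open Finset
open scoped Classical

/-- Distance from a real number to the nearest integer. -/
noncomputable def distNearestInt (t : ℝ) : ℝ := |t - round t|

/-- More than `M / L + 1` elements of `[M, 2M)` contain two distinct ones at distance less
than `L`. -/
theorem exists_lt_sub_lt_of_card_gt {M L : ℕ} (hL : 0 < L) {S : Finset ℕ}
    (hS : S ⊆ Finset.Ico M (2 * M)) (hcard : M / L + 1 < S.card) :
    ∃ x ∈ S, ∃ y ∈ S, x < y ∧ y - x < L := by
  have hmaps : ∀ x ∈ S, (x - M) / L ∈ Finset.range (M / L + 1) := by
    intro x hx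
    have hx' := Finset.mem_Ico.mp (hS hx)
    exact Finset.mem_range.mpr (Nat.lt_succ_of_le (Nat.div_le_div_right (by omega)))
  obtain ⟨x, hx, y, hy, hxy, hdiv⟩ :=
    Finset.exists_ne_map_eq_of_card_lt_of_maps_to (by simpa using hcard) hmaps
  have hxM := Finset.mem_Ico.mp (hS hx)
  have hyM := Finset.mem_Ico.mp (hS hy)
  have hmodx := Nat.mod_lt (x - M) hL
  have hmody := Nat.mod_lt (y - M) hL
  have hxd := Nat.div_add_mod (x - M) L
  have hyd := Nat.div_add_mod (y - M) L
  rw [hdiv] at hxd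
  rcases lt_or_gt_of_ne hxy with h | h
  · exact ⟨x, hx, y, hy, h, by omega⟩
  · exact ⟨y, hy, x, hx, h, by omega⟩

/-- Passing to lowest terms preserves the quality of a rational approximation. -/
theorem exists_coprime_abs_sub_div_le {α ε : ℝ} (hε : 0 ≤ ε) {b : ℤ} {n : ℕ} (hn : 0 < n)
    (h : |(n : ℝ) * α - b| ≤ ε) :
    ∃ a : ℤ, ∃ q : ℕ, 1 ≤ q ∧ q ≤ n ∧ Int.gcd a q = 1 ∧ |α - (a : ℝ) / q| ≤ ε / q := by
  have hn' : (0 : ℝ) < n := by exact_mod_cast hn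
  set r : ℚ := (b : ℚ) / (n : ℚ) with hr
  have hden : r.den ≤ n := by
    have hdvd : (r.den : ℤ) ∣ n := by
      have := Rat.den_dvd b n
      rwa [Rat.divInt_eq_div, Int.cast_natCast] at this
    exact Nat.le_of_dvd hn (by exact_mod_cast hdvd)
  have hpos : (0 : ℝ) < r.den := by exact_mod_cast r.den_pos
  have hreal : (r.num : ℝ) / r.den = b / n := by
    rw [← Rat.cast_def, hr]
    push_cast
    rfl
  refine ⟨r.num, r.den, r.den_pos, hden, ?_, ?_⟩
  · simpa [Int.gcd] using r.reduced
  · rw [hreal]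
    calc |α - b / n| = |(n : ℝ) * α - b| / n := by
          rw [show α - b / n = ((n : ℝ) * α - b) / n by field_simp, abs_div, abs_of_pos hn']
      _ ≤ ε / n := by gcongr
      _ ≤ ε / r.den := by gcongr

/-- Let `α ∈ ℝ`, `M ≥ 1`, `T > 0` and `2/M < δ ≤ 1`. If the number of integers
`M ≤ x < 2M` with `‖xα‖ < T` exceeds `δM`, then there are coprime integers `a`, `q` with
`1 ≤ q ≤ 2/δ` and `|α − a/q| ≤ 2T/q`. -/
theorem pigeonhole_rational_approx (α : ℝ) (M : ℕ) (hM : 0 < M) (T : ℝ) (hT : 0 < T)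
    (δ : ℝ) (hδ₁ : 2 / (M : ℝ) < δ) (hδ₂ : δ ≤ 1)
    (hcard : δ * M <
      (((Finset.Ico M (2 * M)).filter (fun x => distNearestInt ((x : ℝ) * α) < T)).card : ℝ)) :
    ∃ a : ℤ, ∃ q : ℕ, 1 ≤ q ∧ (q : ℝ) ≤ 2 / δ ∧ Int.gcd a q = 1 ∧
      |α - (a : ℝ) / q| ≤ 2 * T / q := by
  have hM' : (0 : ℝ) < M := by exact_mod_cast hM
  have hδ : 0 < δ := lt_trans (by positivity) hδ₁
  have hδM : 2 < δ * M := (div_lt_iff₀ hM').mp hδ₁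
  set L := ⌊2 / δ⌋₊ + 1 with hL
  have hlt : 2 / δ < (L : ℝ) := by
    rw [hL]
    exact_mod_cast Nat.lt_floor_add_one (2 / δ)
  have hLpos : (0 : ℝ) < L := lt_trans (by positivity) hlt
  have hblocks : ((M / L : ℕ) : ℝ) ≤ δ * M / 2 := by
    refine Nat.cast_div_le.trans ?_
    rw [div_lt_iff₀ hδ] at hlt
    rw [div_le_iff₀ hLpos]
    nlinarith
  have hcard' : δ * M <
      (((Finset.Ico M (2 * M)).filter
        (fun x : ℕ => distNearestInt ((x : ℝ) * α) < T)).card : ℝ) := by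
    refine hcard.trans_le (Nat.cast_le.mpr ?_)
    refine le_trans (Finset.card_le_card fun z hz => ?_)
      (Finset.card_image_le (f := fun x : ℕ => (x : ℝ)))
    obtain ⟨hz, hzT⟩ := Finset.mem_filter.mp hz
    obtain ⟨x, hx, rfl⟩ : ∃ x ∈ Finset.Ico M (2 * M), (x : ℝ) = z := by
      simpa [eq_comm, and_assoc] using hz
    exact Finset.mem_image_of_mem _ (Finset.mem_filter.mpr ⟨hx, hzT⟩)
  obtain ⟨x, hx, y, hy, hxy, hsub⟩ :=
    exists_lt_sub_lt_of_card_gt (M := M) (L := L) (by omega) (Finset.filter_subset _ _) (by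
      have : ((M / L : ℕ) : ℝ) + 1 < _ := lt_trans (by linarith) hcard'
      exact_mod_cast this)
  have hxT : |(x : ℝ) * α - round ((x : ℝ) * α)| < T := (Finset.mem_filter.mp hx).2
  have hyT : |(y : ℝ) * α - round ((y : ℝ) * α)| < T := (Finset.mem_filter.mp hy).2
  obtain ⟨a, q, hq, hqn, hgcd, happrox⟩ := exists_coprime_abs_sub_div_le (α := α) (ε := 2 * T)
    (b := round ((y : ℝ) * α) - round ((x : ℝ) * α)) (by positivity) (Nat.sub_pos_of_lt hxy) (by
      rw [Nat.cast_sub hxy.le]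
      push_cast
      rw [abs_lt] at hxT hyT
      rw [abs_le]
      constructor <;> linarith [hxT.1, hxT.2, hyT.1, hyT.2])
  refine ⟨a, q, hq, ?_, hgcd, happrox⟩
  exact (Nat.le_floor_iff (by positivity)).mp (by omega)
end
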